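/- arXiv:math/0405358 — 2 statements merged into one kernel-verified Lean document; each statement's English description precedes it below -/
import Mathlib

section
/- There exist β₀ > 0 and L > 0 such that for all β ≤ β₀, all h ≥ 0, all N ≥ 1, all sequences (t₁,…,t_N) with t₁²+⋯+t_N² = 1, and all k ≥ 1, ν((Σ_{i=1}^N t_i σ̄_i)^{2k}) ≤ (Lk)^k, where σ̄ = σ¹ − σ² is the difference of two independent replicas. -/
open MeasureTheory ProbabilityTheory Finset

noncomputable section

/-- A spin configuration on `N` sites. -/
abbrev Cfg (N : ℕ) := Fin N → Bool

/-- The spin value `±1` of a Boolean. -/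
def spin (b : Bool) : ℝ := if b then 1 else -1

/-- Minus the SK Hamiltonian. -/
def negH (N : ℕ) (β h : ℝ) (g : Fin N → Fin N → ℝ) (σ : Cfg N) : ℝ :=
  (β / Real.sqrt N) *
      ∑ i : Fin N, ∑ j : Fin N, (if i < j then g i j * spin (σ i) * spin (σ j) else 0) +
    h * ∑ i : Fin N, spin (σ i)

/-- Gibbs average `⟨f⟩` of a function of `ι`-indexed replicas. -/
def gibbs (N : ℕ) (β h : ℝ) (g : Fin N → Fin N → ℝ) {ι : Type} [DecidableEq ι] [Fintype ι]
    (f : (ι → Cfg N) → ℝ) : ℝ :=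
  (∑ σs : ι → Cfg N, f σs * ∏ l, Real.exp (negH N β h g (σs l))) /
    (∑ σ : Cfg N, Real.exp (negH N β h g σ)) ^ (Fintype.card ι)

/-- The law of the disorder: i.i.d. standard Gaussians. -/
def gaussN (N : ℕ) : Measure (Fin N → Fin N → ℝ) :=
  Measure.pi fun _ => Measure.pi fun _ => gaussianReal 0 1

/-- `ν(f) = E⟨f⟩`. -/
def nu (N : ℕ) (β h : ℝ) {ι : Type} [DecidableEq ι] [Fintype ι]
    (f : (ι → Cfg N) → ℝ) : ℝ :=
  ∫ g, gibbs N β h g f ∂ gaussN N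

/-- `S_l = Σ_i t_i (σ_i^{1(l)} - σ_i^{2(l)})`, replica pairs indexed by `Fin m × Fin 2`. -/
def Sbar (N m : ℕ) (t : Fin N → ℝ) (σs : Fin m × Fin 2 → Cfg N) (l : Fin m) : ℝ :=
  ∑ i, t i * (spin (σs (l, 0) i) - spin (σs (l, 1) i))

/-- `a(k)`: the `k`-th moment of a standard Gaussian. -/
def gaussMoment (k : ℕ) : ℝ := ∫ x, x ^ k ∂ (gaussianReal 0 1 : Measure ℝ)

/-- The overlap `R_{l,l'}` of two configurations. -/
def overlap (N : ℕ) (σ τ : Cfg N) : ℝ := (∑ i, spin (σ i) * spin (τ i)) / N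

/-- The law of a finite family of i.i.d. standard Gaussians. -/
def stdGaussianPi (A : Type) [Fintype A] : Measure (A → ℝ) :=
  Measure.pi fun _ => gaussianReal 0 1

instance (A : Type) [Fintype A] : IsProbabilityMeasure (stdGaussianPi A) := by
  unfold stdGaussianPi; infer_instance

/-- Stein's identity for the standard Gaussian. -/
lemma integral_mul_gaussianReal {k k' : ℝ → ℝ} (hk : ∀ x, HasDerivAt k (k' x) x)
    {C C' : ℝ} (hC : ∀ x, |k x| ≤ C) (hC' : ∀ x, |k' x| ≤ C') (hk'm : Measurable k') :
    ∫ x, x * k x ∂gaussianReal 0 1 = ∫ x, k' x ∂gaussianReal 0 1 := by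
  have hkc : Continuous k := continuous_iff_continuousAt.2 fun x => (hk x).continuousAt
  simp only [integral_gaussianReal_eq_integral_smul one_ne_zero, smul_eq_mul]
  have hφ : ∀ x, HasDerivAt (gaussianPDFReal 0 1) (-x * gaussianPDFReal 0 1 x) x := by
    intro x
    have h1 : HasDerivAt (fun y : ℝ => -(y - 0) ^ 2 / (2 * ((1 : NNReal) : ℝ))) (-x) x := by
      have := (((hasDerivAt_id x).sub_const 0).pow 2).neg.div_const (2 * ((1 : NNReal) : ℝ))
      exact this.congr_deriv (by simp; ring)
    have h2 := (h1.exp).const_mul ((√(2 * Real.pi * ((1 : NNReal) : ℝ)))⁻¹)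
    exact h2.congr_deriv (by simp only [gaussianPDFReal]; ring)
  have hi0 := integrable_gaussianPDFReal 0 1
  have hi1 : Integrable (fun x => x * gaussianPDFReal 0 1 x) := by
    have : Integrable (fun x : ℝ => x * Real.exp (-(1 / 2) * x ^ 2)) :=
      integrable_mul_exp_neg_mul_sq (by norm_num)
    refine (this.const_mul ((√(2 * Real.pi * ((1 : NNReal) : ℝ)))⁻¹)).congr ?_
    refine ae_of_all _ fun x => ?_
    simp only [gaussianPDFReal]
    rw [show -(x - 0) ^ 2 / (2 * ((1 : NNReal) : ℝ)) = -(1 / 2) * x ^ 2 by simp; ring]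
    ring
  have h := integral_mul_deriv_eq_deriv_mul_of_integrable (u := k) (u' := k')
    (v := gaussianPDFReal 0 1) (v' := fun x => -x * gaussianPDFReal 0 1 x)
    (fun x _ => hk x) (fun x _ => hφ x) ?_ ?_ ?_
  · have e1 : ∀ x, gaussianPDFReal 0 1 x * (x * k x)
        = -(k x * (-x * gaussianPDFReal 0 1 x)) := fun x => by ring
    simp_rw [e1]
    rw [integral_neg, h, neg_neg]
    exact integral_congr_ae (ae_of_all _ fun x => mul_comm _ _)
  · have := (hi1.bdd_mul (c := C) hkc.aestronglyMeasurable
      (ae_of_all _ fun x => by simpa using hC x)).neg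
    refine this.congr (ae_of_all _ fun x => ?_)
    simp
  · exact hi0.bdd_mul (c := C') hk'm.aestronglyMeasurable
      (ae_of_all _ fun x => by simpa using hC' x)
  · exact hi0.bdd_mul (c := C) hkc.aestronglyMeasurable
      (ae_of_all _ fun x => by simpa using hC x)

section Stein

variable {A : Type} [Fintype A]

/-- Resampling one coordinate preserves the law. -/
lemma measurePreserving_update_stdGaussianPi [DecidableEq A] (a : A) :
    MeasurePreserving (fun p : ℝ × (A → ℝ) => Function.update p.2 a p.1)
      ((gaussianReal 0 1).prod (stdGaussianPi A)) (stdGaussianPi A) := by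
  have hm : Measurable (fun p : ℝ × (A → ℝ) => Function.update p.2 a p.1) := by
    refine measurable_pi_iff.2 fun i => ?_
    by_cases h : i = a
    · subst h; simpa using measurable_fst
    · simp only [Function.update_of_ne h]; fun_prop
  refine ⟨hm, ?_⟩
  refine (Measure.pi_eq fun s hs => ?_).symm
  rw [Measure.map_apply hm (MeasurableSet.univ_pi hs)]
  have : (fun p : ℝ × (A → ℝ) => Function.update p.2 a p.1) ⁻¹' Set.univ.pi s
      = s a ×ˢ Set.univ.pi (Function.update s a Set.univ) := by
    ext ⟨x, g⟩
    simp only [Set.mem_preimage, Set.mem_pi, Set.mem_univ, true_implies, Set.mem_prod]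
    constructor
    · intro h
      refine ⟨by simpa using h a, fun i => ?_⟩
      by_cases hi : i = a
      · subst hi; simp
      · simpa [hi] using h i
    · rintro ⟨h1, h2⟩ i
      by_cases hi : i = a
      · subst hi; simpa using h1
      · simpa [hi] using h2 i
  rw [this, Measure.prod_prod, stdGaussianPi, Measure.pi_pi,
    ← Finset.mul_prod_erase univ _ (mem_univ a),
    ← Finset.mul_prod_erase univ (fun i => gaussianReal 0 1 (s i)) (mem_univ a)]
  simp only [Function.update_self, measure_univ, one_mul]
  congr 1
  refine prod_congr rfl fun i hi => ?_
  rw [Function.update_of_ne (ne_of_mem_erase hi)]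

lemma integrable_eval_stdGaussianPi (a : A) :
    Integrable (fun g : A → ℝ => g a) (stdGaussianPi A) := by
  have h : MeasurePreserving (Function.eval a) (stdGaussianPi A) (gaussianReal 0 1) :=
    measurePreserving_eval _ a
  exact h.integrable_comp_of_integrable (g := fun x : ℝ => x)
    ((memLp_id_gaussianReal 1).integrable le_rfl)

lemma integrable_of_bounded_continuous {K : (A → ℝ) → ℝ} (hK : Continuous K) {C : ℝ}
    (hC : ∀ g, |K g| ≤ C) : Integrable K (stdGaussianPi A) :=
  Integrable.of_bound hK.aestronglyMeasurable C (ae_of_all _ fun g => by simpa using hC g)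

/-- Gaussian integration by parts. -/
lemma integral_eval_mul_stdGaussianPi [DecidableEq A] (a : A) {K K' : (A → ℝ) → ℝ}
    (hKc : Continuous K)
    (hK'c : Continuous K')
    (hd : ∀ g x, HasDerivAt (fun y => K (Function.update g a y)) (K' (Function.update g a x)) x)
    {C C' : ℝ} (hC : ∀ g, |K g| ≤ C) (hC' : ∀ g, |K' g| ≤ C') :
    ∫ g, g a * K g ∂stdGaussianPi A = ∫ g, K' g ∂stdGaussianPi A := by
  have hmp := measurePreserving_update_stdGaussianPi a
  have key : ∀ F : (A → ℝ) → ℝ, Integrable F (stdGaussianPi A) →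
      ∫ g, F g ∂stdGaussianPi A
        = ∫ g, ∫ x, F (Function.update g a x) ∂gaussianReal 0 1 ∂stdGaussianPi A := by
    intro F hF
    conv_lhs => rw [← hmp.map_eq]
    rw [integral_map hmp.measurable.aemeasurable
      (by rw [hmp.map_eq]; exact hF.aestronglyMeasurable)]
    exact integral_prod_symm _ (hmp.integrable_comp_of_integrable hF)
  have hi1 : Integrable (fun g : A → ℝ => g a * K g) (stdGaussianPi A) :=
    (integrable_eval_stdGaussianPi a).mul_bdd (c := C) hKc.aestronglyMeasurable
      (ae_of_all _ fun x => by simpa using hC x)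
  rw [key _ hi1, key _ (integrable_of_bounded_continuous hK'c hC')]
  refine integral_congr_ae (ae_of_all _ fun g => ?_)
  simp only [Function.update_self]
  have hu : Continuous fun x : ℝ => Function.update g a x := by fun_prop
  exact integral_mul_gaussianReal (hd g) (fun x => hC _) (fun x => hC' _)
    (hK'c.comp hu).measurable

end Stein

section FiniteGibbs

variable {X : Type} [Fintype X]

/-- The Gibbs probability of `x` for the energy vector `e`. -/
def gibbsWeight (e : X → ℝ) (x : X) : ℝ := Real.exp (e x) / ∑ y, Real.exp (e y)

/-- The Gibbs average of a function of one replica. -/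
def avg (e : X → ℝ) (u : X → ℝ) : ℝ := ∑ x, gibbsWeight e x * u x

/-- The Gibbs average of a function of two replicas. -/
def avg₂ (e : X → ℝ) (f : X → X → ℝ) : ℝ :=
  ∑ x, ∑ y, gibbsWeight e x * gibbsWeight e y * f x y

lemma gibbsWeight_nonneg (e : X → ℝ) (x : X) : 0 ≤ gibbsWeight e x := by
  unfold gibbsWeight; positivity

lemma sum_exp_pos [Nonempty X] (e : X → ℝ) : 0 < ∑ y, Real.exp (e y) :=
  sum_pos (fun _ _ => Real.exp_pos _) univ_nonempty

lemma sum_gibbsWeight [Nonempty X] (e : X → ℝ) : ∑ x, gibbsWeight e x = 1 := by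
  unfold gibbsWeight
  rw [← sum_div, div_self (sum_exp_pos e).ne']

lemma avg_const [Nonempty X] (e : X → ℝ) (c : ℝ) : avg e (fun _ => c) = c := by
  simp [avg, ← sum_mul, sum_gibbsWeight]

lemma avg₂_const [Nonempty X] (e : X → ℝ) (c : ℝ) : avg₂ e (fun _ _ => c) = c := by
  simp only [avg₂, ← sum_mul, ← mul_sum, sum_gibbsWeight, mul_one, one_mul]

lemma avg₂_add (e : X → ℝ) (f g : X → X → ℝ) :
    avg₂ e (fun x y => f x y + g x y) = avg₂ e f + avg₂ e g := by
  simp only [avg₂, mul_add, sum_add_distrib]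

lemma avg₂_const_mul (e : X → ℝ) (c : ℝ) (f : X → X → ℝ) :
    avg₂ e (fun x y => c * f x y) = c * avg₂ e f := by
  simp only [avg₂, mul_sum]
  exact sum_congr rfl fun x _ => sum_congr rfl fun y _ => by ring

lemma avg₂_sum {A : Type} [Fintype A] (e : X → ℝ) (f : A → X → X → ℝ) :
    avg₂ e (fun x y => ∑ a, f a x y) = ∑ a, avg₂ e (f a) := by
  simp only [avg₂, mul_sum]
  simp_rw [sum_comm (s := univ (α := X)) (t := univ (α := A))]

lemma avg₂_mono (e : X → ℝ) {f g : X → X → ℝ} (h : ∀ x y, f x y ≤ g x y) :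
    avg₂ e f ≤ avg₂ e g :=
  sum_le_sum fun x _ => sum_le_sum fun y _ => mul_le_mul_of_nonneg_left (h x y)
    (mul_nonneg (gibbsWeight_nonneg e x) (gibbsWeight_nonneg e y))

lemma avg₂_nonneg (e : X → ℝ) {f : X → X → ℝ} (h : ∀ x y, 0 ≤ f x y) : 0 ≤ avg₂ e f :=
  sum_nonneg fun x _ => sum_nonneg fun y _ => mul_nonneg
    (mul_nonneg (gibbsWeight_nonneg e x) (gibbsWeight_nonneg e y)) (h x y)

lemma abs_avg_le [Nonempty X] (e : X → ℝ) {u : X → ℝ} {C : ℝ} (h : ∀ x, |u x| ≤ C) :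
    |avg e u| ≤ C := by
  calc |avg e u| ≤ ∑ x, |gibbsWeight e x * u x| := abs_sum_le_sum_abs _ _
    _ ≤ ∑ x, gibbsWeight e x * C := sum_le_sum fun x _ => by
        rw [abs_mul, abs_of_nonneg (gibbsWeight_nonneg e x)]
        exact mul_le_mul_of_nonneg_left (h x) (gibbsWeight_nonneg e x)
    _ = C := avg_const e C

lemma abs_avg₂_le [Nonempty X] (e : X → ℝ) {f : X → X → ℝ} {C : ℝ} (h : ∀ x y, |f x y| ≤ C) :
    |avg₂ e f| ≤ C := by
  rw [abs_le]
  refine ⟨?_, ?_⟩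
  · rw [← avg₂_const e (-C)]
    exact avg₂_mono e fun x y => (abs_le.1 (h x y)).1
  · rw [← avg₂_const e C]
    exact avg₂_mono e fun x y => (abs_le.1 (h x y)).2

lemma hasDerivAt_gibbsWeight [Nonempty X] {e : ℝ → X → ℝ} {e' : X → ℝ} {t : ℝ}
    (he : ∀ x, HasDerivAt (fun s => e s x) (e' x) t) (x : X) :
    HasDerivAt (fun s => gibbsWeight (e s) x)
      (gibbsWeight (e t) x * (e' x - avg (e t) e')) t := by
  have hZ : HasDerivAt (fun s => ∑ y, Real.exp (e s y)) (∑ y, Real.exp (e t y) * e' y) t :=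
    HasDerivAt.fun_sum fun y _ => (he y).exp
  refine ((he x).exp.div hZ (sum_exp_pos (e t)).ne').congr_deriv ?_
  have hZ0 := (sum_exp_pos (e t)).ne'
  have : avg (e t) e' = (∑ y, Real.exp (e t y) * e' y) / ∑ y, Real.exp (e t y) := by
    rw [avg, sum_div]
    exact sum_congr rfl fun y _ => by rw [gibbsWeight]; ring
  rw [this, gibbsWeight]
  field_simp

lemma hasDerivAt_avg [Nonempty X] {e : ℝ → X → ℝ} {e' : X → ℝ} {t : ℝ}
    (he : ∀ x, HasDerivAt (fun s => e s x) (e' x) t) (u : X → ℝ) :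
    HasDerivAt (fun s => avg (e s) u)
      (avg (e t) (fun x => u x * e' x) - avg (e t) u * avg (e t) e') t := by
  refine (HasDerivAt.fun_sum fun x _ =>
    (hasDerivAt_gibbsWeight he x).mul_const (u x)).congr_deriv ?_
  conv_rhs => rw [avg, avg, sum_mul, ← sum_sub_distrib]
  exact sum_congr rfl fun x _ => by ring

lemma hasDerivAt_avg₂ [Nonempty X] {e : ℝ → X → ℝ} {e' : X → ℝ} {f : ℝ → X → X → ℝ}
    {f' : X → X → ℝ} {t : ℝ} (he : ∀ x, HasDerivAt (fun s => e s x) (e' x) t)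
    (hf : ∀ x y, HasDerivAt (fun s => f s x y) (f' x y) t) :
    HasDerivAt (fun s => avg₂ (e s) (f s))
      (avg₂ (e t) fun x y => f t x y * (e' x + e' y - 2 * avg (e t) e') + f' x y) t := by
  refine (HasDerivAt.fun_sum fun x _ => HasDerivAt.fun_sum fun y _ =>
    ((hasDerivAt_gibbsWeight he x).mul (hasDerivAt_gibbsWeight he y)).mul
      (hf x y)).congr_deriv ?_
  exact sum_congr rfl fun x _ => sum_congr rfl fun y _ => by simp only [Pi.mul_apply]; ring

lemma continuous_gibbsWeight [Nonempty X] {T : Type} [TopologicalSpace T] {e : T → X → ℝ}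
    (he : ∀ x, Continuous fun s => e s x) (x : X) : Continuous fun s => gibbsWeight (e s) x :=
  (Real.continuous_exp.comp (he x)).div
    (continuous_finsetSum _ fun y _ => Real.continuous_exp.comp (he y))
    fun s => (sum_exp_pos (e s)).ne'

lemma continuous_avg [Nonempty X] {T : Type} [TopologicalSpace T] {e : T → X → ℝ}
    {u : T → X → ℝ} (he : ∀ x, Continuous fun s => e s x) (hu : ∀ x, Continuous fun s => u s x) :
    Continuous fun s => avg (e s) (u s) :=
  continuous_finsetSum _ fun x _ => (continuous_gibbsWeight he x).mul (hu x)

lemma continuous_avg₂ [Nonempty X] {T : Type} [TopologicalSpace T] {e : T → X → ℝ}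
    {f : T → X → X → ℝ} (he : ∀ x, Continuous fun s => e s x)
    (hf : ∀ x y, Continuous fun s => f s x y) :
    Continuous fun s => avg₂ (e s) (f s) :=
  continuous_finsetSum _ fun x _ => continuous_finsetSum _ fun y _ =>
    ((continuous_gibbsWeight he x).mul (continuous_gibbsWeight he y)).mul (hf x y)

/-- Chebyshev's association inequality for `exp (l * U)` and `U`. -/
lemma avg₂_exp_mul_avg₂_le [Nonempty X] (e : X → ℝ) {U : X → X → ℝ} {l : ℝ} (hl : 0 ≤ l) :
    avg₂ e (fun x y => Real.exp (l * U x y)) * avg₂ e U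
      ≤ avg₂ e fun x y => Real.exp (l * U x y) * U x y := by
  set F : X → X → ℝ := fun x y => Real.exp (l * U x y) with hF
  have key : 0 ≤ avg₂ e fun x y => avg₂ e fun x' y' =>
      (F x y - F x' y') * (U x y - U x' y') := by
    refine avg₂_nonneg e fun x y => avg₂_nonneg e fun x' y' => ?_
    rcases le_total (U x y) (U x' y') with h | h
    · exact mul_nonneg_of_nonpos_of_nonpos (sub_nonpos.2 (Real.exp_le_exp.2
        (mul_le_mul_of_nonneg_left h hl))) (sub_nonpos.2 h)
    · exact mul_nonneg (sub_nonneg.2 (Real.exp_le_exp.2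
        (mul_le_mul_of_nonneg_left h hl))) (sub_nonneg.2 h)
  have inner : ∀ x y, (avg₂ e fun x' y' => (F x y - F x' y') * (U x y - U x' y'))
      = F x y * U x y + ((-avg₂ e U) * F x y + ((-avg₂ e F) * U x y
        + avg₂ e fun x y => F x y * U x y)) := by
    intro x y
    have : (fun x' y' => (F x y - F x' y') * (U x y - U x' y'))
        = fun x' y' => F x y * U x y + ((-F x y) * U x' y' + ((-U x y) * F x' y'
          + F x' y' * U x' y')) := by
      funext x' y'; ring
    rw [this, avg₂_add, avg₂_add, avg₂_add, avg₂_const, avg₂_const_mul, avg₂_const_mul]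
    ring
  simp_rw [inner] at key
  rw [avg₂_add, avg₂_add, avg₂_add, avg₂_const, avg₂_const_mul, avg₂_const_mul] at key
  linarith

/-- The second-order term of Gaussian interpolation, for weights `κ` whose covariance kernel is
a nonnegative kernel `V ≤ ρ U` up to an additive constant. -/
lemma sum_mul_avg₂_le [Nonempty X] {A : Type} [Fintype A] (e : X → ℝ) {U V : X → X → ℝ}
    {l ρ v₀ κ₀ : ℝ} (hl : 0 ≤ l) (hρ : 0 ≤ ρ) (κ : A → ℝ) (w : A → X → ℝ)
    (hΓ : ∀ x y, ∑ a, κ a * (w a x * w a y) = V x y + κ₀)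
    (hV : ∀ x y, 0 ≤ V x y) (hVU : ∀ x y, V x y ≤ ρ * U x y) (hVd : ∀ x, V x x = v₀) :
    ∑ a, κ a * avg₂ e (fun x y => Real.exp (l * U x y) *
        ((w a x + w a y - 2 * avg e (w a)) ^ 2
          - 2 * (avg e (fun z => w a z * w a z) - avg e (w a) * avg e (w a))))
      ≤ 8 * ρ * avg₂ e fun x y => Real.exp (l * U x y) * U x y := by
  set p := gibbsWeight e with hp
  have hp1 : ∑ z, p z = 1 := sum_gibbsWeight e
  have hp0 : ∀ z, 0 ≤ p z := gibbsWeight_nonneg e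
  have h1 : ∀ x, ∑ a, κ a * (w a x * avg e (w a)) = ∑ z, p z * V x z + κ₀ := by
    intro x
    have : ∀ a, κ a * (w a x * avg e (w a)) = ∑ z, p z * (κ a * (w a x * w a z)) := by
      intro a
      rw [avg, mul_sum, mul_sum]
      exact sum_congr rfl fun z _ => by ring
    simp_rw [this]
    rw [sum_comm]
    simp_rw [← mul_sum, hΓ, mul_add, sum_add_distrib, ← sum_mul, hp1, one_mul]
  have h2 : ∑ a, κ a * (avg e (w a) * avg e (w a)) = avg₂ e V + κ₀ := by
    have : ∀ a, κ a * (avg e (w a) * avg e (w a))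
        = ∑ x, p x * (κ a * (w a x * avg e (w a))) := by
      intro a
      conv_lhs => rw [show avg e (w a) * avg e (w a) = (∑ x, p x * w a x) * avg e (w a) from rfl]
      rw [sum_mul, mul_sum]
      exact sum_congr rfl fun z _ => by ring
    simp_rw [this]
    rw [sum_comm]
    simp_rw [← mul_sum, h1, mul_add, sum_add_distrib, ← sum_mul, hp1, one_mul, avg₂, mul_sum,
      mul_assoc, ← hp]
  have h3 : ∑ a, κ a * avg e (fun z => w a z * w a z) = v₀ + κ₀ := by
    have : ∀ a, κ a * avg e (fun z => w a z * w a z)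
        = ∑ z, p z * (κ a * (w a z * w a z)) := by
      intro a
      rw [avg, mul_sum]
      exact sum_congr rfl fun z _ => by ring
    simp_rw [this]
    rw [sum_comm]
    simp_rw [← mul_sum, hΓ, hVd, ← sum_mul, hp1, one_mul]
  have h4 : ∀ x y, ∑ a, κ a * ((w a x + w a y - 2 * avg e (w a)) ^ 2
        - 2 * (avg e (fun z => w a z * w a z) - avg e (w a) * avg e (w a)))
      = 2 * V x y - 4 * ∑ z, p z * V x z - 4 * ∑ z, p z * V y z + 6 * avg₂ e V := by
    intro x y
    have : ∀ a, κ a * ((w a x + w a y - 2 * avg e (w a)) ^ 2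
        - 2 * (avg e (fun z => w a z * w a z) - avg e (w a) * avg e (w a)))
        = κ a * (w a x * w a x) + κ a * (w a y * w a y) + 2 * (κ a * (w a x * w a y))
          - 4 * (κ a * (w a x * avg e (w a))) - 4 * (κ a * (w a y * avg e (w a)))
          + 6 * (κ a * (avg e (w a) * avg e (w a)))
          - 2 * (κ a * avg e (fun z => w a z * w a z)) := fun a => by ring
    simp_rw [this]
    simp only [sum_add_distrib, sum_sub_distrib, ← mul_sum, hΓ, h1, h2, h3, hVd]
    ring
  have h5 : ∑ a, κ a * avg₂ e (fun x y => Real.exp (l * U x y) *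
        ((w a x + w a y - 2 * avg e (w a)) ^ 2
          - 2 * (avg e (fun z => w a z * w a z) - avg e (w a) * avg e (w a))))
      = avg₂ e fun x y => Real.exp (l * U x y) *
        (2 * V x y - 4 * ∑ z, p z * V x z - 4 * ∑ z, p z * V y z + 6 * avg₂ e V) := by
    simp_rw [← h4, mul_sum, avg₂_sum, ← avg₂_const_mul]
    refine sum_congr rfl fun a _ => ?_
    congr 1
    funext x y
    ring
  rw [h5]
  have hVavg : avg₂ e V ≤ ρ * avg₂ e U := by
    rw [← avg₂_const_mul]; exact avg₂_mono e hVU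
  calc _ ≤ avg₂ e fun x y => (2 * ρ) * (Real.exp (l * U x y) * U x y)
          + (6 * (ρ * avg₂ e U)) * Real.exp (l * U x y) := by
        refine avg₂_mono e fun x y => ?_
        have a1 : 0 ≤ ∑ z, p z * V x z := sum_nonneg fun z _ => mul_nonneg (hp0 z) (hV x z)
        have a2 : 0 ≤ ∑ z, p z * V y z := sum_nonneg fun z _ => mul_nonneg (hp0 z) (hV y z)
        have := mul_le_mul_of_nonneg_left
          (show 2 * V x y - 4 * ∑ z, p z * V x z - 4 * ∑ z, p z * V y z + 6 * avg₂ e V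
            ≤ 2 * (ρ * U x y) + 6 * (ρ * avg₂ e U) by linarith [hVU x y])
          (Real.exp_pos (l * U x y)).le
        linarith
    _ = 2 * ρ * (avg₂ e fun x y => Real.exp (l * U x y) * U x y)
          + 6 * (ρ * avg₂ e U) * avg₂ e fun x y => Real.exp (l * U x y) := by
        rw [avg₂_add, avg₂_const_mul, avg₂_const_mul]
    _ ≤ _ := by
        have := mul_le_mul_of_nonneg_left (avg₂_exp_mul_avg₂_le e (U := U) hl) hρ
        linarith

end FiniteGibbs

section Interpolation

variable {X : Type} {A : Type} [Fintype A]

/-- The Gaussian energy `∑ a, c a t * g a * w a x + b x` along a path of coefficients. -/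
def pathEnergy (w : A → X → ℝ) (b : X → ℝ) (c : A → ℝ → ℝ) (t : ℝ) (g : A → ℝ) (x : X) : ℝ :=
  ∑ a, c a t * g a * w a x + b x

variable {w : A → X → ℝ} {b : X → ℝ} {c c' : A → ℝ → ℝ}

lemma continuous_pathEnergy (t : ℝ) (x : X) : Continuous fun g => pathEnergy w b c t g x := by
  unfold pathEnergy; fun_prop

lemma hasDerivAt_pathEnergy_update [DecidableEq A] (t : ℝ) (g : A → ℝ) (a : A) (x : X) (s : ℝ) :
    HasDerivAt (fun r => pathEnergy w b c t (Function.update g a r) x) (c a t * w a x) s := by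
  have : (fun r => pathEnergy w b c t (Function.update g a r) x)
      = fun r => c a t * r * w a x + (∑ i ∈ univ.erase a, c i t * g i * w i x + b x) := by
    funext r
    rw [pathEnergy, ← add_sum_erase _ _ (mem_univ a), Function.update_self, add_assoc]
    congr 2
    exact sum_congr rfl fun i hi => by rw [Function.update_of_ne (ne_of_mem_erase hi)]
  rw [this]
  exact ((((hasDerivAt_id s).const_mul (c a t)).mul_const (w a x)).add_const _).congr_deriv
    (by simp)

lemma hasDerivAt_pathEnergy (hc : ∀ a t, HasDerivAt (c a) (c' a t) t) (t : ℝ) (g : A → ℝ)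
    (x : X) :
    HasDerivAt (fun s => pathEnergy w b c s g x) (∑ a, c' a t * g a * w a x) t :=
  (HasDerivAt.fun_sum fun a _ => ((hc a t).mul_const (g a)).mul_const (w a x)).add_const _

lemma exists_forall_abs_le [Fintype X] (w : A → X → ℝ) : ∃ W, 0 ≤ W ∧ ∀ a x, |w a x| ≤ W := by
  refine ⟨∑ a, ∑ x, |w a x|, by positivity, fun a x => ?_⟩
  exact (single_le_sum (f := fun x => |w a x|) (fun _ _ => abs_nonneg _) (mem_univ x)).trans
    (single_le_sum (f := fun a => ∑ x, |w a x|) (fun _ _ => by positivity) (mem_univ a))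

/-- Gaussian interpolation for two-replica averages. -/
lemma hasDerivAt_integral_avg₂ [Fintype X] [Nonempty X] (hc : ∀ a t, HasDerivAt (c a) (c' a t) t)
    (hc1 : ∀ a t, |c a t| ≤ 1) (hc'1 : ∀ a t, |c' a t| ≤ 1) {f f' : ℝ → X → X → ℝ}
    (hf : ∀ t x y, HasDerivAt (fun s => f s x y) (f' t x y) t) {F F' : ℝ}
    (hF : ∀ t x y, |f t x y| ≤ F) (hF' : ∀ t x y, |f' t x y| ≤ F') (t : ℝ) :
    HasDerivAt (fun t => ∫ g, avg₂ (pathEnergy w b c t g) (f t) ∂stdGaussianPi A)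
      (∫ g, (avg₂ (pathEnergy w b c t g) (f' t) + ∑ a, c' a t * c a t *
        avg₂ (pathEnergy w b c t g) (fun x y => f t x y *
          ((w a x + w a y - 2 * avg (pathEnergy w b c t g) (w a)) ^ 2
            - 2 * (avg (pathEnergy w b c t g) (fun z => w a z * w a z)
              - avg (pathEnergy w b c t g) (w a) * avg (pathEnergy w b c t g) (w a)))))
        ∂stdGaussianPi A) t := by
  classical
  obtain ⟨W, hW0, hW⟩ := exists_forall_abs_le w
  have hF0 : 0 ≤ F := (abs_nonneg _).trans (hF 0 (Classical.arbitrary X) (Classical.arbitrary X))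
  set E := pathEnergy w b c with hE
  have hEc : ∀ t x, Continuous fun g => E t g x := fun t x => continuous_pathEnergy t x
  set K : A → ℝ → (A → ℝ) → ℝ := fun a t g =>
    avg₂ (E t g) (fun x y => f t x y * (w a x + w a y - 2 * avg (E t g) (w a))) with hK
  have hm : ∀ a t g, |avg (E t g) (w a)| ≤ W := fun a t g => abs_avg_le _ (hW a)
  have hd4 : ∀ a t g x y, |w a x + w a y - 2 * avg (E t g) (w a)| ≤ 4 * W := by
    intro a t g x y
    have h1 := abs_le.1 (hW a x); have h2 := abs_le.1 (hW a y); have h3 := abs_le.1 (hm a t g)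
    exact abs_le.2 ⟨by linarith, by linarith⟩
  have hKb : ∀ a t g, |K a t g| ≤ F * (4 * W) := by
    intro a t g
    refine abs_avg₂_le _ fun x y => ?_
    rw [abs_mul]
    exact mul_le_mul (hF t x y) (hd4 a t g x y) (abs_nonneg _) hF0
  have hKc : ∀ a t, Continuous (K a t) := by
    intro a t
    refine continuous_avg₂ (hEc t) fun x y => ?_
    have := continuous_avg (u := fun _ => w a) (hEc t) (fun x => continuous_const)
    fun_prop
  have hsq : ∀ a x, |w a x * w a x| ≤ W * W := fun a x => by
    rw [abs_mul]; exact mul_le_mul (hW a x) (hW a x) (abs_nonneg _) hW0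
  set Q : A → ℝ → (A → ℝ) → X → X → ℝ := fun a t g x y =>
    (w a x + w a y - 2 * avg (E t g) (w a)) ^ 2
      - 2 * (avg (E t g) (fun z => w a z * w a z) - avg (E t g) (w a) * avg (E t g) (w a)) with hQ
  have hQb : ∀ a t g x y, |Q a t g x y| ≤ 20 * (W * W) := by
    intro a t g x y
    have h1 := abs_le.1 (abs_avg_le (E t g) (hsq a))
    have h2 : |avg (E t g) (w a) * avg (E t g) (w a)| ≤ W * W := by
      rw [abs_mul]; exact mul_le_mul (hm a t g) (hm a t g) (abs_nonneg _) hW0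
    have h3 := abs_le.1 h2
    have h4 : (w a x + w a y - 2 * avg (E t g) (w a)) ^ 2 ≤ 16 * (W * W) := by
      have := sq_le_sq' (abs_le.1 (hd4 a t g x y)).1 (abs_le.1 (hd4 a t g x y)).2
      linarith
    have h5 := sq_nonneg (w a x + w a y - 2 * avg (E t g) (w a))
    exact abs_le.2 ⟨by simp only [hQ]; linarith, by simp only [hQ]; linarith⟩
  have hQc : ∀ a t x y, Continuous fun g => Q a t g x y := by
    intro a t x y
    have h1 := continuous_avg (u := fun _ => w a) (hEc t) (fun x => continuous_const)
    have h2 := continuous_avg (u := fun _ z => w a z * w a z) (hEc t) (fun x => continuous_const)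
    fun_prop
  have hfQ : ∀ a t g x y, |f t x y * Q a t g x y| ≤ F * (20 * (W * W)) := by
    intro a t g x y
    rw [abs_mul]
    exact mul_le_mul (hF t x y) (hQb a t g x y) (abs_nonneg _) hF0
  have ibp : ∀ a, ∫ g, g a * K a t g ∂stdGaussianPi A
      = ∫ g, c a t * avg₂ (E t g) (fun x y => f t x y * Q a t g x y) ∂stdGaussianPi A := by
    intro a
    refine integral_eval_mul_stdGaussianPi a (hKc a t)
      (continuous_const.mul (continuous_avg₂ (hEc t) fun x y =>
        continuous_const.mul (hQc a t x y))) ?_ (hKb a t)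
      (C' := 1 * (F * (20 * (W * W)))) ?_
    · intro g x
      have he := fun z => hasDerivAt_pathEnergy_update (w := w) (b := b) (c := c) t g a z x
      refine (hasDerivAt_avg₂ he (f := fun s x y => f t x y * (w a x + w a y - 2 *
        avg (E t (Function.update g a s)) (w a))) fun u v =>
        (((hasDerivAt_avg he (w a)).const_mul 2).const_sub (w a u + w a v)).const_mul
          (f t u v)).congr_deriv ?_
      rw [← avg₂_const_mul]
      congr 1
      funext u v
      have l1 : ∀ q : X → ℝ, avg (pathEnergy w b c t (Function.update g a x))
          (fun z => q z * (c a t * w a z))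
          = c a t * avg (pathEnergy w b c t (Function.update g a x)) (fun z => q z * w a z) := by
        intro q
        rw [avg, avg, mul_sum]
        exact sum_congr rfl fun z _ => by ring
      have l2 : avg (pathEnergy w b c t (Function.update g a x)) (fun z => c a t * w a z)
          = c a t * avg (pathEnergy w b c t (Function.update g a x)) (w a) := by
        rw [avg, avg, mul_sum]
        exact sum_congr rfl fun z _ => by ring
      rw [l1, l2]
      simp only [hQ, hE]
      ring
    · intro g
      rw [abs_mul]
      exact mul_le_mul (hc1 a t) (abs_avg₂_le _ (hfQ a t g)) (abs_nonneg _) zero_le_one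
  have hi' : ∀ t, Integrable (fun g => avg₂ (E t g) (f' t)) (stdGaussianPi A) := fun t =>
    integrable_of_bounded_continuous (continuous_avg₂ (hEc t) fun x y => continuous_const)
      fun g => abs_avg₂_le _ (hF' t)
  have hiK : ∀ a, Integrable (fun g => c' a t * (g a * K a t g)) (stdGaussianPi A) := fun a =>
    ((integrable_eval_stdGaussianPi a).mul_bdd (c := F * (4 * W)) (hKc a t).aestronglyMeasurable
      (ae_of_all _ fun x => by simpa using hKb a t x)).const_mul _
  have hi : ∀ s, Integrable (fun g => avg₂ (E s g) (f s)) (stdGaussianPi A) := fun s =>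
    integrable_of_bounded_continuous (continuous_avg₂ (hEc s) fun x y => continuous_const)
      fun g => abs_avg₂_le _ (hF s)
  have hF'int : Integrable (fun g => avg₂ (E t g) (f' t) + ∑ a, c' a t * (g a * K a t g))
      (stdGaussianPi A) := (hi' t).add (integrable_finsetSum _ fun a _ => hiK a)
  have main := hasDerivAt_integral_of_dominated_loc_of_deriv_le (μ := stdGaussianPi A)
    (F := fun t g => avg₂ (E t g) (f t))
    (F' := fun t g => avg₂ (E t g) (f' t) + ∑ a, c' a t * (g a * K a t g))
    (bound := fun g => F' + ∑ a, |g a| * (F * (4 * W))) (x₀ := t) Filter.univ_mem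
    (Filter.Eventually.of_forall fun s => (hi s).aestronglyMeasurable) (hi t)
    hF'int.aestronglyMeasurable ?_ ?_ ?_
  · refine main.2.congr_deriv ?_
    rw [integral_add (hi' t) (integrable_finsetSum _ fun a _ => hiK a),
      integral_finsetSum _ fun a _ => hiK a]
    have hiQ : ∀ a, Integrable (fun g => c' a t * c a t *
        avg₂ (E t g) (fun x y => f t x y * Q a t g x y)) (stdGaussianPi A) := fun a =>
      (integrable_of_bounded_continuous (C := F * (20 * (W * W)))
        (continuous_avg₂ (hEc t) fun x y => continuous_const.mul (hQc a t x y)) fun g =>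
        abs_avg₂_le _ (hfQ a t g)).const_mul _
    rw [integral_add (hi' t) (integrable_finsetSum _ fun a _ => hiQ a),
      integral_finsetSum _ fun a _ => hiQ a]
    congr 1
    refine sum_congr rfl fun a _ => ?_
    rw [integral_const_mul, ibp a, ← integral_const_mul]
    simp_rw [mul_assoc]
  · refine ae_of_all _ fun g s _ => ?_
    rw [Real.norm_eq_abs]
    refine (abs_add_le _ _).trans (add_le_add (abs_avg₂_le _ (hF' s))
      ((abs_sum_le_sum_abs _ _).trans (sum_le_sum fun a _ => ?_)))
    rw [abs_mul, abs_mul]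
    calc |c' a s| * (|g a| * |K a s g|) ≤ 1 * (|g a| * (F * (4 * W))) :=
          mul_le_mul (hc'1 a s) (mul_le_mul_of_nonneg_left (hKb a s g) (abs_nonneg _))
            (by positivity) zero_le_one
      _ = _ := one_mul _
  · exact (integrable_const _).add (integrable_finsetSum _ fun a _ =>
      (integrable_eval_stdGaussianPi a).abs.mul_const _)
  · refine ae_of_all _ fun g s _ => ?_
    refine (hasDerivAt_avg₂ (fun x => hasDerivAt_pathEnergy hc s g x) (hf s)).congr_deriv ?_
    rw [avg₂_add, add_comm]
    congr 1
    simp_rw [hK, ← mul_assoc, ← avg₂_const_mul, ← avg₂_sum]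
    congr 1
    funext x y
    have : avg (pathEnergy w b c s g) (fun x => ∑ a, c' a s * g a * w a x)
        = ∑ a, c' a s * g a * avg (E s g) (w a) := by
      simp_rw [avg, mul_sum]
      rw [sum_comm]
      exact sum_congr rfl fun a _ => sum_congr rfl fun z _ => by ring
    rw [this, mul_sum, ← sum_add_distrib, ← sum_sub_distrib, mul_sum]
    exact sum_congr rfl fun a _ => by ring

end Interpolation

section Comparison

variable {X P I : Type} [Fintype X] [Nonempty X] [Fintype P] [Fintype I]

/-- Coefficients of the rotation exchanging the `P`-indexed and the `I`-indexed Gaussians. -/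
def rotCoeff : P ⊕ I → ℝ → ℝ := Sum.elim (fun _ => Real.sin) (fun _ => Real.cos)

/-- Along the rotation path, a change of exponent compensates the change of covariance. -/
theorem integral_avg₂_exp_le (w : P ⊕ I → X → ℝ) (b : X → ℝ) {U V : X → X → ℝ}
    {l₀ ρ v₀ κ₀ : ℝ} (hl : 0 ≤ l₀) (hρ : 0 ≤ ρ)
    (hΓ : ∀ x y, ∑ p, w (.inl p) x * w (.inl p) y - ∑ i, w (.inr i) x * w (.inr i) y
      = V x y + κ₀)
    (hV : ∀ x y, 0 ≤ V x y) (hVU : ∀ x y, V x y ≤ ρ * U x y) (hVd : ∀ x, V x x = v₀) :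
    ∫ g, avg₂ (pathEnergy w b rotCoeff (Real.pi / 2) g) (fun x y => Real.exp (l₀ * U x y))
        ∂stdGaussianPi (P ⊕ I)
      ≤ ∫ g, avg₂ (pathEnergy w b rotCoeff 0 g) (fun x y => Real.exp ((l₀ + 4 * ρ) * U x y))
        ∂stdGaussianPi (P ⊕ I) := by
  set c' : P ⊕ I → ℝ → ℝ := Sum.elim (fun _ => Real.cos) (fun _ t => -Real.sin t) with hc'
  set l : ℝ → ℝ := fun t => l₀ + 4 * ρ * Real.cos t ^ 2 with hldef
  set l' : ℝ → ℝ := fun t => -(8 * ρ * (Real.sin t * Real.cos t)) with hl'def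
  have hll : ∀ t, HasDerivAt l (l' t) t := fun t =>
    ((((Real.hasDerivAt_cos t).pow 2).const_mul (4 * ρ)).const_add l₀).congr_deriv
      (by simp [hl'def]; ring)
  have hl0 : ∀ t, 0 ≤ l t := fun t => by simp only [hldef]; positivity
  have hlb : ∀ t, |l t| ≤ l₀ + 4 * ρ := fun t => by
    rw [abs_of_nonneg (hl0 t)]
    have := mul_le_mul_of_nonneg_left (Real.cos_sq_le_one t) (by positivity : 0 ≤ 4 * ρ)
    simp only [hldef]; linarith
  have hl'b : ∀ t, |l' t| ≤ 8 * ρ := fun t => by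
    simp only [hl'def, abs_neg, abs_mul, abs_of_nonneg hρ]
    have := mul_le_mul (Real.abs_sin_le_one t) (Real.abs_cos_le_one t) (abs_nonneg _) zero_le_one
    have := mul_le_mul_of_nonneg_left this (by positivity : 0 ≤ 8 * ρ)
    simpa using this
  obtain ⟨B, hB0, hB⟩ := exists_forall_abs_le U
  have hexp : ∀ t x y, |Real.exp (l t * U x y)| ≤ Real.exp ((l₀ + 4 * ρ) * B) := by
    intro t x y
    rw [Real.abs_exp]
    refine Real.exp_le_exp.2 ((le_abs_self _).trans ?_)
    rw [abs_mul]
    exact mul_le_mul (hlb t) (hB x y) (abs_nonneg _) (by positivity)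
  have hder := hasDerivAt_integral_avg₂ (w := w) (b := b) (c := rotCoeff) (c' := c')
    (f := fun t x y => Real.exp (l t * U x y))
    (f' := fun t x y => l' t * (Real.exp (l t * U x y) * U x y))
    (F := Real.exp ((l₀ + 4 * ρ) * B)) (F' := 8 * ρ * (Real.exp ((l₀ + 4 * ρ) * B) * B))
    (by
      rintro (p | i) t
      · exact Real.hasDerivAt_sin t
      · exact Real.hasDerivAt_cos t)
    (by
      rintro (p | i) t
      · exact Real.abs_sin_le_one t
      · exact Real.abs_cos_le_one t)
    (by
      rintro (p | i) t
      · exact Real.abs_cos_le_one t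
      · simpa [hc'] using Real.abs_sin_le_one t)
    (fun t x y => (((hll t).mul_const (U x y)).exp).congr_deriv (by ring)) hexp
    (fun t x y => by
      rw [abs_mul, abs_mul]
      exact mul_le_mul (hl'b t) (mul_le_mul (hexp t x y) (hB x y) (abs_nonneg _)
        (Real.exp_pos _).le) (by positivity) (by positivity))
  have hanti : AntitoneOn (fun t => ∫ g, avg₂ (pathEnergy w b rotCoeff t g)
      (fun x y => Real.exp (l t * U x y)) ∂stdGaussianPi (P ⊕ I))
      (Set.Icc 0 (Real.pi / 2)) := by
    refine antitoneOn_of_deriv_nonpos (convex_Icc _ _)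
      (fun t _ => (hder t).continuousAt.continuousWithinAt)
      (fun t _ => (hder t).differentiableAt.differentiableWithinAt) fun t ht => ?_
    rw [interior_Icc] at ht
    have hs : 0 ≤ Real.sin t * Real.cos t := mul_nonneg
      (Real.sin_nonneg_of_nonneg_of_le_pi ht.1.le (by linarith [ht.2, Real.pi_pos]))
      (Real.cos_nonneg_of_neg_pi_div_two_le_of_le (by linarith [ht.1, Real.pi_pos]) ht.2.le)
    rw [(hder t).deriv]
    refine integral_nonpos fun g => ?_
    have hmain := sum_mul_avg₂_le (pathEnergy w b rotCoeff t g) (U := U)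
      (V := fun x y => (Real.sin t * Real.cos t) * V x y) (ρ := (Real.sin t * Real.cos t) * ρ)
      (v₀ := (Real.sin t * Real.cos t) * v₀) (κ₀ := (Real.sin t * Real.cos t) * κ₀)
      (hl0 t) (mul_nonneg hs hρ) (fun a => c' a t * rotCoeff a t) w
      (fun x y => by
        rw [← mul_add, ← hΓ, Fintype.sum_sum_type, mul_sub, mul_sum, mul_sum, sub_eq_add_neg,
          ← sum_neg_distrib]
        congr 1
        · exact sum_congr rfl fun p _ => by simp only [hc', rotCoeff, Sum.elim_inl]; ring
        · exact sum_congr rfl fun p _ => by simp only [hc', rotCoeff, Sum.elim_inr]; ring)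
      (fun x y => mul_nonneg hs (hV x y))
      (fun x y => (mul_le_mul_of_nonneg_left (hVU x y) hs).trans_eq (by ring))
      (fun x => by simp only [hVd])
    rw [avg₂_const_mul]
    refine (add_le_add_right hmain _).trans (le_of_eq ?_)
    simp only [hl'def, Pi.zero_apply]
    ring
  have h := hanti (a := 0) (b := Real.pi / 2) (by constructor <;> linarith [Real.pi_pos])
    (by constructor <;> linarith [Real.pi_pos]) (by linarith [Real.pi_pos])
  simpa [hldef] using h

end Comparison

section Decoupled

lemma exp_le_add_exp_sq (x : ℝ) : Real.exp x ≤ x + Real.exp (x ^ 2) := by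
  have h0 := Real.add_one_le_exp (x ^ 2)
  rcases le_total |x| 1 with h | h
  · have := (abs_le.1 (Real.abs_exp_sub_one_sub_id_le h)).2
    linarith
  · rcases le_total 0 x with hx | hx
    · rw [abs_of_nonneg hx] at h
      have : Real.exp x ≤ Real.exp (x ^ 2) := Real.exp_le_exp.2 (by nlinarith)
      linarith
    · rw [abs_of_nonpos hx] at h
      have : Real.exp x ≤ 1 := Real.exp_le_one_iff.2 hx
      nlinarith

/-- Linearisation of a square by a Gaussian variable. -/
lemma sum_mul_exp_sq_le_two {Q : Type} [Fintype Q] {p S : Q → ℝ}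
    (h : ∀ u : ℝ, ∑ x, p x * Real.exp (u * S x) ≤ Real.exp (4 * u ^ 2)) {l : ℝ} (hl : 0 ≤ l)
    (hl' : l ≤ 1 / 32) : ∑ x, p x * Real.exp (l * S x ^ 2) ≤ 2 := by
  have hlin : ∀ a : ℝ, Real.exp (l * a ^ 2)
      = ∫ z, Real.exp ((√(2 * l) * a) * z) ∂gaussianReal 0 1 := by
    intro a
    have := congr_fun (mgf_fun_id_gaussianReal (μ := 0) (v := 1)) (√(2 * l) * a)
    simp only [mgf] at this
    rw [this, mul_pow, Real.sq_sqrt (by positivity)]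
    congr 1
    push_cast
    ring
  have hint : ∀ x ∈ (univ : Finset Q), Integrable
      (fun z => p x * Real.exp ((√(2 * l) * S x) * z)) (gaussianReal 0 1) := fun x _ =>
    (integrable_exp_mul_gaussianReal _).const_mul _
  simp_rw [hlin, ← integral_const_mul]
  rw [← integral_finsetSum _ hint]
  have hφ : ∀ z : ℝ, gaussianPDFReal 0 1 z * Real.exp (z ^ 2 / 4)
      = (√(2 * Real.pi))⁻¹ * Real.exp (-(1 / 4) * z ^ 2) := by
    intro z
    simp only [gaussianPDFReal, NNReal.coe_one, mul_one, sub_zero]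
    rw [mul_assoc, ← Real.exp_add]
    congr 2
    ring
  have hgi : Integrable (fun z : ℝ => Real.exp (z ^ 2 / 4)) (gaussianReal 0 1) := by
    rw [gaussianReal_of_var_ne_zero _ one_ne_zero]
    refine (integrable_withDensity_iff_integrable_smul' (measurable_gaussianPDF 0 1)
      (ae_of_all _ fun x => gaussianPDF_lt_top)).2 ?_
    simp only [toReal_gaussianPDF, smul_eq_mul, hφ]
    exact (integrable_exp_neg_mul_sq (by norm_num)).const_mul _
  calc _ ≤ ∫ z, Real.exp (z ^ 2 / 4) ∂gaussianReal 0 1 := by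
        refine integral_mono (integrable_finsetSum _ hint) hgi fun z => ?_
        have := h (√(2 * l) * z)
        refine le_trans (le_of_eq ?_) (this.trans (Real.exp_le_exp.2 ?_))
        · exact sum_congr rfl fun x _ => by rw [mul_right_comm]
        · rw [mul_pow, Real.sq_sqrt (by positivity)]
          nlinarith [sq_nonneg z]
    _ = √2 := by
        simp only [integral_gaussianReal_eq_integral_smul one_ne_zero, smul_eq_mul, hφ]
        rw [integral_const_mul, integral_gaussian, ← Real.sqrt_inv, ← Real.sqrt_mul (by positivity)]
        congr 1
        have := Real.pi_ne_zero
        field_simp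
        norm_num
    _ ≤ 2 := by
        rw [Real.sqrt_le_left (by norm_num)]; norm_num

lemma abs_spin (b : Bool) : |spin b| = 1 := by cases b <;> simp [spin]

lemma spin_sq (b : Bool) : spin b ^ 2 = 1 := by cases b <;> simp [spin]

/-- The energy of one spin in an external field. -/
def fieldEnergy (r : ℝ) (x : Bool) : ℝ := r * spin x

lemma gibbsWeight_field {I : Type} [Fintype I] [DecidableEq I] (r : I → ℝ) (σ : I → Bool) :
    gibbsWeight (fun σ : I → Bool => ∑ i, r i * spin (σ i)) σ
      = ∏ i, gibbsWeight (fieldEnergy (r i)) (σ i) := by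
  simp only [gibbsWeight, fieldEnergy, Real.exp_sum, prod_div_distrib]
  rw [prod_univ_sum, Fintype.piFinset_univ]

/-- A decoupled two-replica average of a product factorises over the sites. -/
lemma avg₂_field_exp {I : Type} [Fintype I] [DecidableEq I] (r : I → ℝ)
    (φ : I → Bool → Bool → ℝ) (u : ℝ) :
    avg₂ (fun σ : I → Bool => ∑ i, r i * spin (σ i))
        (fun σ τ => Real.exp (u * ∑ i, φ i (σ i) (τ i)))
      = ∏ i, avg₂ (fieldEnergy (r i)) (fun x y => Real.exp (u * φ i x y)) := by
  simp only [avg₂, gibbsWeight_field, mul_sum, Real.exp_sum, ← prod_mul_distrib]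
  have h : ∀ i, (∑ x, ∑ y, gibbsWeight (fieldEnergy (r i)) x * gibbsWeight (fieldEnergy (r i)) y
      * Real.exp (u * φ i x y)) = ∑ q : Bool × Bool, gibbsWeight (fieldEnergy (r i)) q.1 *
        gibbsWeight (fieldEnergy (r i)) q.2 * Real.exp (u * φ i q.1 q.2) := fun i => by
    rw [Fintype.sum_prod_type]
  simp_rw [h]
  rw [prod_univ_sum, Fintype.piFinset_univ, ← Fintype.sum_prod_type'
    (f := fun (σ τ : I → Bool) => ∏ i, gibbsWeight (fieldEnergy (r i)) (σ i) *
      gibbsWeight (fieldEnergy (r i)) (τ i) * Real.exp (u * φ i (σ i) (τ i)))]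
  exact (Fintype.sum_equiv (Equiv.arrowProdEquivProdArrow I (fun _ => Bool) fun _ => Bool)
    _ _ fun f => rfl).symm

lemma continuous_fieldEnergy {T : Type} [TopologicalSpace T] {r : T → ℝ} (hr : Continuous r)
    (x : Bool) : Continuous fun s => fieldEnergy (r s) x := hr.mul continuous_const

/-- Hoeffding-type bound for one site. -/
lemma integral_avg₂_field_exp_le {r : ℝ → ℝ} (hr : Continuous r) {φ : Bool → Bool → ℝ} {c u : ℝ}
    (hφ : ∀ x y, |φ x y| ≤ 2 * c)
    (h0 : ∫ z, avg₂ (fieldEnergy (r z)) φ ∂gaussianReal 0 1 = 0) :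
    ∫ z, avg₂ (fieldEnergy (r z)) (fun x y => Real.exp (u * φ x y)) ∂gaussianReal 0 1
      ≤ Real.exp (4 * u ^ 2 * c ^ 2) := by
  have hint : ∀ f : Bool → Bool → ℝ, Integrable (fun z => avg₂ (fieldEnergy (r z)) f)
      (gaussianReal 0 1) := by
    intro f
    obtain ⟨B, -, hB⟩ := exists_forall_abs_le f
    have hc : Continuous fun z => avg₂ (fieldEnergy (r z)) f :=
      continuous_avg₂ (e := fun z => fieldEnergy (r z)) (f := fun _ => f)
        (fun x => continuous_fieldEnergy hr x) fun x y => continuous_const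
    exact Integrable.of_bound hc.aestronglyMeasurable B
      (ae_of_all _ fun z => abs_avg₂_le _ hB)
  have hb : ∀ z, avg₂ (fieldEnergy (r z)) (fun x y => Real.exp (u * φ x y))
      ≤ u * avg₂ (fieldEnergy (r z)) φ + Real.exp (4 * u ^ 2 * c ^ 2) := by
    intro z
    rw [← avg₂_const_mul, ← avg₂_const (fieldEnergy (r z)) (Real.exp _), ← avg₂_add]
    refine avg₂_mono _ fun x y => (exp_le_add_exp_sq _).trans ?_
    refine add_le_add_right (Real.exp_le_exp.2 ?_) _
    rw [mul_pow]
    have := sq_le_sq' (abs_le.1 (hφ x y)).1 (abs_le.1 (hφ x y)).2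
    nlinarith [sq_nonneg u]
  have hu : Integrable (fun z => u * avg₂ (fieldEnergy (r z)) φ) (gaussianReal 0 1) :=
    (hint φ).const_mul u
  have hk : Integrable (fun _ : ℝ => Real.exp (4 * u ^ 2 * c ^ 2)) (gaussianReal 0 1) :=
    integrable_const _
  have hs : Integrable (fun z => u * avg₂ (fieldEnergy (r z)) φ + Real.exp (4 * u ^ 2 * c ^ 2))
      (gaussianReal 0 1) := hu.add hk
  refine (integral_mono (hint _) hs hb).trans (le_of_eq ?_)
  rw [integral_add hu hk, integral_const_mul, h0, integral_const, probReal_univ]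
  simp

/-- Sub-Gaussian bound for a sum of independent centred site observables. -/
lemma integral_avg₂_field_exp_sum_le {P I : Type} [Fintype P] [Fintype I] [DecidableEq I]
    {r : ℝ → ℝ} (hr : Continuous r) {φ : I → Bool → Bool → ℝ} {c : I → ℝ}
    (hφ : ∀ i x y, |φ i x y| ≤ 2 * c i) (hc : ∑ i, c i ^ 2 = 1)
    (h0 : ∀ i, ∫ z, avg₂ (fieldEnergy (r z)) (φ i) ∂gaussianReal 0 1 = 0) (u : ℝ) :
    ∫ g : P ⊕ I → ℝ, avg₂ (fun σ : I → Bool => ∑ i, r (g (.inr i)) * spin (σ i))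
        (fun σ τ => Real.exp (u * ∑ i, φ i (σ i) (τ i))) ∂stdGaussianPi (P ⊕ I)
      ≤ Real.exp (4 * u ^ 2) := by
  have hfac := integral_fintype_prod_eq_prod (𝕜 := ℝ) (ι := P ⊕ I)
    (μ := fun _ => gaussianReal 0 1) (Sum.elim (fun _ _ => (1 : ℝ)) fun i z =>
      avg₂ (fieldEnergy (r z)) (fun x y => Real.exp (u * φ i x y)))
  simp only [Fintype.prod_sum_type, Sum.elim_inl, Sum.elim_inr, prod_const_one, one_mul,
    integral_const, probReal_univ, smul_eq_mul, mul_one] at hfac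
  simp only [avg₂_field_exp]
  rw [stdGaussianPi, hfac]
  calc _ ≤ ∏ i, Real.exp (4 * u ^ 2 * c i ^ 2) := by
        refine prod_le_prod (fun i _ => integral_nonneg fun z =>
          avg₂_nonneg _ fun x y => (Real.exp_pos _).le) fun i _ =>
          integral_avg₂_field_exp_le hr (hφ i) (h0 i)
    _ = _ := by rw [← Real.exp_sum, ← mul_sum, hc, mul_one]

lemma gibbsWeight_le_one {X : Type} [Fintype X] [Nonempty X] (e : X → ℝ) (x : X) :
    gibbsWeight e x ≤ 1 := by
  rw [← sum_gibbsWeight e]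
  exact single_le_sum (fun y _ => gibbsWeight_nonneg e y) (mem_univ x)

/-- Averaging over the disorder turns a two-replica average into a fixed weighted sum. -/
lemma exists_integral_avg₂_eq_sum {A X : Type} [Fintype A] [Fintype X] [Nonempty X]
    {e : (A → ℝ) → X → ℝ} (he : ∀ x, Continuous fun g => e g x) :
    ∃ p : X × X → ℝ, (∀ q, 0 ≤ p q) ∧ ∀ f : X → X → ℝ,
      ∫ g, avg₂ (e g) f ∂stdGaussianPi A = ∑ q, p q * f q.1 q.2 := by
  have hpi : ∀ x y, Integrable (fun g => gibbsWeight (e g) x * gibbsWeight (e g) y)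
      (stdGaussianPi A) := fun x y =>
    integrable_of_bounded_continuous (C := 1)
      ((continuous_gibbsWeight he x).mul (continuous_gibbsWeight he y)) fun g => by
        rw [abs_of_nonneg (mul_nonneg (gibbsWeight_nonneg _ _) (gibbsWeight_nonneg _ _))]
        exact mul_le_one₀ (gibbsWeight_le_one _ x) (gibbsWeight_nonneg _ _)
          (gibbsWeight_le_one _ y)
  refine ⟨fun q => ∫ g, gibbsWeight (e g) q.1 * gibbsWeight (e g) q.2 ∂stdGaussianPi A,
    fun q => integral_nonneg fun g => mul_nonneg (gibbsWeight_nonneg _ _) (gibbsWeight_nonneg _ _),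
    fun f => ?_⟩
  simp only [avg₂]
  have h1 : ∀ x y, Integrable (fun g => gibbsWeight (e g) x * gibbsWeight (e g) y * f x y)
      (stdGaussianPi A) := fun x y => (hpi x y).mul_const _
  have h2 : ∀ x, Integrable (fun g => ∑ y, gibbsWeight (e g) x * gibbsWeight (e g) y * f x y)
      (stdGaussianPi A) := fun x => integrable_finsetSum _ fun y _ => h1 x y
  rw [integral_finsetSum _ fun x _ => h2 x, Fintype.sum_prod_type]
  refine sum_congr rfl fun x _ => ?_
  rw [integral_finsetSum _ fun y _ => h1 x y]
  exact sum_congr rfl fun y _ => integral_mul_const _ _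

lemma integral_avg₂_mono {A X : Type} [Fintype A] [Fintype X] [Nonempty X]
    {e : (A → ℝ) → X → ℝ} (he : ∀ x, Continuous fun g => e g x) {f f' : X → X → ℝ}
    (hff' : ∀ x y, f x y ≤ f' x y) :
    ∫ g, avg₂ (e g) f ∂stdGaussianPi A ≤ ∫ g, avg₂ (e g) f' ∂stdGaussianPi A := by
  obtain ⟨p, hp0, hp⟩ := exists_integral_avg₂_eq_sum he
  rw [hp, hp]
  exact sum_le_sum fun q _ => mul_le_mul_of_nonneg_left (hff' _ _) (hp0 q)

/-- Exponential square integrability of a sum of independent centred site observables. -/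
lemma integral_avg₂_exp_sq_le_two {P I : Type} [Fintype P] [Fintype I] [DecidableEq I]
    {r : ℝ → ℝ} (hr : Continuous r) {φ : I → Bool → Bool → ℝ} {c : I → ℝ}
    (hφ : ∀ i x y, |φ i x y| ≤ 2 * c i) (hc : ∑ i, c i ^ 2 = 1)
    (h0 : ∀ i, ∫ z, avg₂ (fieldEnergy (r z)) (φ i) ∂gaussianReal 0 1 = 0) {l : ℝ} (hl : 0 ≤ l)
    (hl' : l ≤ 1 / 32) :
    ∫ g : P ⊕ I → ℝ, avg₂ (fun σ : I → Bool => ∑ i, r (g (.inr i)) * spin (σ i))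
        (fun σ τ => Real.exp (l * (∑ i, φ i (σ i) (τ i)) ^ 2)) ∂stdGaussianPi (P ⊕ I) ≤ 2 := by
  obtain ⟨p, -, hp⟩ := exists_integral_avg₂_eq_sum
    (e := fun (g : P ⊕ I → ℝ) (σ : I → Bool) => ∑ i, r (g (.inr i)) * spin (σ i))
    fun σ => by fun_prop
  have h : ∀ u, ∑ q, p q * Real.exp (u * ∑ i, φ i (q.1 i) (q.2 i)) ≤ Real.exp (4 * u ^ 2) := by
    intro u
    have := integral_avg₂_field_exp_sum_le (P := P) hr hφ hc h0 u
    rwa [hp] at this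
  rw [hp]
  exact sum_mul_exp_sq_le_two h hl hl'

lemma avg₂_spin_mul_spin_sub (e : Bool → ℝ) (q : ℝ) :
    avg₂ e (fun x y => spin x * spin y - q) = avg e spin ^ 2 - q := by
  have h : avg₂ e (fun x y => spin x * spin y) = avg e spin ^ 2 := by
    rw [sq, avg, sum_mul_sum, avg₂]
    exact sum_congr rfl fun x _ => sum_congr rfl fun y _ => by ring
  simp only [sub_eq_add_neg]
  rw [avg₂_add, avg₂_const, h]

/-- The replica-symmetric fixed point. -/
lemma exists_overlap_fixedPoint (β h : ℝ) : ∃ q ∈ Set.Icc (0 : ℝ) 1,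
    ∫ z, avg₂ (fieldEnergy (β * √q * z + h)) (fun x y => spin x * spin y - q)
      ∂gaussianReal 0 1 = 0 := by
  have hb : ∀ r, ‖avg (fieldEnergy r) spin ^ 2‖ ≤ 1 := fun r => by
    rw [norm_pow, Real.norm_eq_abs]
    exact pow_le_one₀ (abs_nonneg _) (abs_avg_le (fieldEnergy r) fun b => (abs_spin b).le)
  have hc : Continuous fun r => avg (fieldEnergy r) spin ^ 2 :=
    Continuous.pow (f := fun r => avg (fieldEnergy r) spin) (continuous_avg (u := fun _ => spin)
      (fun x => continuous_fieldEnergy continuous_id x) fun x => continuous_const) 2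
  have hm : ∀ q : ℝ, AEStronglyMeasurable
      (fun z => avg (fieldEnergy (β * √q * z + h)) spin ^ 2) (gaussianReal 0 1) := fun q =>
    (hc.comp (by fun_prop : Continuous fun z => β * √q * z + h)).aestronglyMeasurable
  have hi : ∀ q : ℝ, Integrable
      (fun z => avg (fieldEnergy (β * √q * z + h)) spin ^ 2) (gaussianReal 0 1) := fun q =>
    Integrable.of_bound (hm q) 1 (ae_of_all _ fun z => hb _)
  have hcont : Continuous fun q : ℝ =>
      ∫ z, avg (fieldEnergy (β * √q * z + h)) spin ^ 2 ∂gaussianReal 0 1 :=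
    continuous_of_dominated (bound := fun _ => 1) hm (fun q => ae_of_all _ fun z => hb _)
      (integrable_const _)
      (ae_of_all _ fun z => hc.comp (by fun_prop : Continuous fun q : ℝ => β * √q * z + h))
  obtain ⟨q, hq, hfix⟩ := exists_mem_Icc_isFixedPt_of_mapsTo hcont.continuousOn zero_le_one
    fun q _ => ⟨integral_nonneg fun z => sq_nonneg _,
      (integral_mono (hi q) (integrable_const 1) fun z => (le_abs_self _).trans (hb _)).trans_eq
        (by simp)⟩
  refine ⟨q, hq, ?_⟩
  have hfix' : ∫ z, avg (fieldEnergy (β * √q * z + h)) spin ^ 2 ∂gaussianReal 0 1 = q := hfix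
  simp only [avg₂_spin_mul_spin_sub]
  rw [integral_sub (hi q) (integrable_const q), hfix']
  simp

end Decoupled

section SherringtonKirkpatrick

lemma sum_sum_ite_lt {N : ℕ} (s : Fin N → ℝ) :
    ∑ i, ∑ j, (if i < j then s i * s j else 0) = ((∑ i, s i) ^ 2 - ∑ i, s i ^ 2) / 2 := by
  have hsymm : ∑ i, ∑ j, (if i < j then s i * s j else 0)
      = ∑ i, ∑ j, (if j < i then s i * s j else 0) := by
    rw [sum_comm]
    simp only [mul_comm]
  have hdiag : ∑ i, s i ^ 2 = ∑ i, ∑ j, (if i = j then s i * s j else 0) := by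
    simp [sq]
  have hsplit : (∑ i, s i) ^ 2 = ∑ i, ∑ j, (if i < j then s i * s j else 0)
      + ∑ i, ∑ j, (if j < i then s i * s j else 0)
      + ∑ i, ∑ j, (if i = j then s i * s j else 0) := by
    rw [sq, sum_mul_sum]
    simp only [← sum_add_distrib]
    refine sum_congr rfl fun i _ => sum_congr rfl fun j _ => ?_
    rcases lt_trichotomy i j with h | h | h
    · simp [h, h.not_gt, h.ne]
    · simp [h]
    · simp [h, h.not_gt, h.ne']
  rw [hsplit, ← hsymm, ← hdiag]
  ring

/-- Interaction and external-field weights of the Gaussians along the interpolation. -/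
def skWeight (N : ℕ) (β q : ℝ) : (Fin N × Fin N) ⊕ Fin N → Cfg N → ℝ :=
  Sum.elim (fun p σ => if p.1 < p.2 then β / √N * (spin (σ p.1) * spin (σ p.2)) else 0)
    (fun i σ => β * √q * spin (σ i))

/-- The rescaled deviation of the overlap from `q`. -/
def overlapDev (N : ℕ) (q : ℝ) (σ τ : Cfg N) : ℝ :=
  ∑ i, (√N)⁻¹ * (spin (σ i) * spin (τ i) - q)

lemma skWeight_covariance (M : ℕ) (β : ℝ) {q : ℝ} (hq : 0 ≤ q) (σ τ : Cfg (M + 1)) :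
    ∑ p, skWeight (M + 1) β q (.inl p) σ * skWeight (M + 1) β q (.inl p) τ
        - ∑ i, skWeight (M + 1) β q (.inr i) σ * skWeight (M + 1) β q (.inr i) τ
      = β ^ 2 / 2 * overlapDev (M + 1) q σ τ ^ 2
        + -(β ^ 2 / 2 * (q ^ 2 * ((M + 1 : ℕ) : ℝ) + 1)) := by
  set s : Fin (M + 1) → ℝ := fun i => spin (σ i) * spin (τ i) with hs
  set n : ℝ := ((M + 1 : ℕ) : ℝ) with hn
  have hn0 : 0 < n := by positivity
  have hsn : √n ^ 2 = n := Real.sq_sqrt hn0.le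
  have hs2 : ∑ i, s i ^ 2 = n := by simp [hs, mul_pow, spin_sq, hn]
  have hlt := sum_sum_ite_lt s
  rw [hs2] at hlt
  have hinl : ∑ p, skWeight (M + 1) β q (.inl p) σ * skWeight (M + 1) β q (.inl p) τ
      = β ^ 2 / n * (((∑ i, s i) ^ 2 - n) / 2) := by
    rw [← hlt, Fintype.sum_prod_type, mul_sum]
    refine sum_congr rfl fun i _ => ?_
    rw [mul_sum]
    refine sum_congr rfl fun j _ => ?_
    simp only [skWeight, Sum.elim_inl]
    split_ifs
    · rw [← hn, ← hsn, ← div_pow, hsn]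
      simp only [hs]
      ring
    · simp
  have hinr : ∑ i, skWeight (M + 1) β q (.inr i) σ * skWeight (M + 1) β q (.inr i) τ
      = β ^ 2 * q * ∑ i, s i := by
    rw [mul_sum]
    refine sum_congr rfl fun i _ => ?_
    simp only [skWeight, Sum.elim_inr, hs]
    rw [← Real.sq_sqrt hq, Real.sqrt_sq (Real.sqrt_nonneg q)]
    ring
  have hA : overlapDev (M + 1) q σ τ = (√n)⁻¹ * (∑ i, s i - n * q) := by
    rw [overlapDev, ← mul_sum, sum_sub_distrib]
    simp [hs, hn]
  rw [hinl, hinr, hA, mul_pow, inv_pow, hsn]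
  field_simp
  ring

/-- The squared test function plus the squared overlap deviation. -/
def controlSq (N : ℕ) (q : ℝ) (t : Fin N → ℝ) (σ τ : Cfg N) : ℝ :=
  (∑ i, t i * (spin (σ i) - spin (τ i))) ^ 2 + overlapDev N q σ τ ^ 2

lemma abs_spin_sub_spin_le (x y : Bool) : |spin x - spin y| ≤ 2 :=
  (abs_sub _ _).trans (by rw [abs_spin, abs_spin]; norm_num)

lemma integral_avg₂_controlSq_le_two {P : Type} [Fintype P] (M : ℕ) {r : ℝ → ℝ}
    (hr : Continuous r) {q : ℝ} (hq : q ∈ Set.Icc (0 : ℝ) 1)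
    (hfix : ∫ z, avg₂ (fieldEnergy (r z)) (fun x y => spin x * spin y - q) ∂gaussianReal 0 1 = 0)
    {t : Fin (M + 1) → ℝ} (ht : ∑ i, t i ^ 2 = 1) {l : ℝ} (hl : 0 ≤ l) (hl' : l ≤ 1 / 64) :
    ∫ g : P ⊕ Fin (M + 1) → ℝ, avg₂ (fun σ : Cfg (M + 1) => ∑ i, r (g (.inr i)) * spin (σ i))
        (fun σ τ => Real.exp (l * controlSq (M + 1) q t σ τ)) ∂stdGaussianPi (P ⊕ Fin (M + 1))
      ≤ 2 := by
  have h1 := integral_avg₂_exp_sq_le_two (P := P) hr (φ := fun i x y => t i * (spin x - spin y))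
    (c := fun i => |t i|) (l := 2 * l)
    (fun i x y => by
      rw [abs_mul, mul_comm]
      exact mul_le_mul_of_nonneg_right (abs_spin_sub_spin_le x y) (abs_nonneg _))
    (by simpa using ht)
    (fun i => by
      have : ∀ e : Bool → ℝ, avg₂ e (fun x y => t i * (spin x - spin y)) = 0 := fun e => by
        simp [avg₂, spin]; ring
      simp [this])
    (by positivity) (by linarith)
  have h2 := integral_avg₂_exp_sq_le_two (P := P) hr
    (φ := fun (_ : Fin (M + 1)) x y => (√((M + 1 : ℕ) : ℝ))⁻¹ * (spin x * spin y - q))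
    (c := fun _ => (√((M + 1 : ℕ) : ℝ))⁻¹) (l := 2 * l)
    (fun i x y => by
      rw [abs_mul, mul_comm, abs_of_nonneg (by positivity : 0 ≤ (√((M + 1 : ℕ) : ℝ))⁻¹)]
      refine mul_le_mul_of_nonneg_right ((abs_sub _ _).trans ?_) (by positivity)
      rw [abs_mul, abs_spin, abs_spin, abs_of_nonneg hq.1]
      linarith [hq.2])
    (by
      simp only [inv_pow, Real.sq_sqrt (Nat.cast_nonneg _), sum_const, card_univ,
        Fintype.card_fin, nsmul_eq_mul]
      exact mul_inv_cancel₀ (by positivity))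
    (fun i => by
      simp only [avg₂_const_mul]
      rw [integral_const_mul, hfix, mul_zero])
    (by positivity) (by linarith)
  obtain ⟨p, hp0, hp⟩ := exists_integral_avg₂_eq_sum
    (e := fun (g : P ⊕ Fin (M + 1) → ℝ) (σ : Cfg (M + 1)) => ∑ i, r (g (.inr i)) * spin (σ i))
    fun σ => by fun_prop
  have hp1 : ∑ q', p q' *
      Real.exp (2 * l * (∑ i, t i * (spin (q'.1 i) - spin (q'.2 i))) ^ 2) ≤ 2 := by
    rwa [hp] at h1
  have hp2 : ∑ q', p q' * Real.exp (2 * l * overlapDev (M + 1) q q'.1 q'.2 ^ 2) ≤ 2 := by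
    rwa [hp] at h2
  rw [hp]
  have hle : ∀ q', p q' * Real.exp (l * controlSq (M + 1) q t q'.1 q'.2)
      ≤ 1 / 2 * (p q' * Real.exp (2 * l * (∑ i, t i * (spin (q'.1 i) - spin (q'.2 i))) ^ 2))
        + 1 / 2 * (p q' * Real.exp (2 * l * overlapDev (M + 1) q q'.1 q'.2 ^ 2)) := by
    intro q'
    set a := (∑ i, t i * (spin (q'.1 i) - spin (q'.2 i))) ^ 2 with ha
    set b := overlapDev (M + 1) q q'.1 q'.2 ^ 2 with hb
    have e1 : Real.exp (l * controlSq (M + 1) q t q'.1 q'.2)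
        = Real.exp (l * a) * Real.exp (l * b) := by
      rw [← Real.exp_add, controlSq, mul_add]
    have e2 : ∀ x, Real.exp (2 * l * x) = Real.exp (l * x) ^ 2 := fun x => by
      rw [sq, ← Real.exp_add]; congr 1; ring
    rw [e1, e2, e2]
    nlinarith [mul_nonneg (hp0 q') (sq_nonneg (Real.exp (l * a) - Real.exp (l * b)))]
  refine (sum_le_sum fun q' _ => hle q').trans ?_
  rw [sum_add_distrib, ← mul_sum, ← mul_sum]
  linarith

lemma continuous_negH (N : ℕ) (β h : ℝ) (σ : Cfg N) :
    Continuous fun g : Fin N → Fin N → ℝ => negH N β h g σ := by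
  refine ((continuous_finsetSum _ fun i _ => continuous_finsetSum _ fun j _ => ?_).const_mul
    (β / √N)).add continuous_const
  split_ifs <;> fun_prop

/-- Exponential square integrability of the test function under the SK Gibbs measure. -/
lemma integral_avg₂_negH_exp_sq_le_two (M : ℕ) {β : ℝ} (h : ℝ) (hβ : 0 ≤ β) (hβ' : β ≤ 1 / 16)
    {t : Fin (M + 1) → ℝ} (ht : ∑ i, t i ^ 2 = 1) :
    ∫ g : (Fin (M + 1) × Fin (M + 1)) ⊕ Fin (M + 1) → ℝ,
        avg₂ (negH (M + 1) β h fun i j => g (.inl (i, j)))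
          (fun σ τ => Real.exp (1 / 128 * (∑ i, t i * (spin (σ i) - spin (τ i))) ^ 2))
        ∂stdGaussianPi ((Fin (M + 1) × Fin (M + 1)) ⊕ Fin (M + 1)) ≤ 2 := by
  obtain ⟨q, hq, hfix⟩ := exists_overlap_fixedPoint β h
  set b : Cfg (M + 1) → ℝ := fun σ => h * ∑ i, spin (σ i) with hb
  have hfield : ∀ g, pathEnergy (skWeight (M + 1) β q) b rotCoeff 0 g
      = fun σ => ∑ i, (β * √q * g (.inr i) + h) * spin (σ i) := by
    intro g
    funext σ
    simp only [pathEnergy, Fintype.sum_sum_type, rotCoeff, skWeight, Sum.elim_inl, Sum.elim_inr,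
      Real.sin_zero, Real.cos_zero, zero_mul, sum_const_zero, zero_add, hb, mul_sum,
      ← sum_add_distrib]
    exact sum_congr rfl fun i _ => by ring
  have hsk : ∀ g, pathEnergy (skWeight (M + 1) β q) b rotCoeff (Real.pi / 2) g
      = negH (M + 1) β h fun i j => g (.inl (i, j)) := by
    intro g
    funext σ
    simp only [pathEnergy, Fintype.sum_sum_type, rotCoeff, skWeight, Sum.elim_inl, Sum.elim_inr,
      Real.sin_pi_div_two, Real.cos_pi_div_two, zero_mul, sum_const_zero, add_zero, one_mul, hb,
      negH, Fintype.sum_prod_type, mul_sum]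
    congr 1
    refine sum_congr rfl fun i _ => sum_congr rfl fun j _ => ?_
    split_ifs <;> ring
  have hrho : 0 ≤ β ^ 2 / 2 := by positivity
  have hsmall : 1 / 128 + 4 * (β ^ 2 / 2) ≤ 1 / 64 := by nlinarith
  have hmain := integral_avg₂_exp_le (skWeight (M + 1) β q) b (U := controlSq (M + 1) q t)
    (l₀ := 1 / 128) (by norm_num) hrho (skWeight_covariance M β hq.1)
    (fun σ τ => by positivity)
    (fun σ τ => mul_le_mul_of_nonneg_left (le_add_of_nonneg_left (sq_nonneg _)) hrho)
    (v₀ := β ^ 2 / 2 * (∑ _i : Fin (M + 1), (√((M + 1 : ℕ) : ℝ))⁻¹ * (1 - q)) ^ 2)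
    (fun σ => by simp only [overlapDev, ← sq, spin_sq])
  simp only [hfield, hsk] at hmain
  have hend := integral_avg₂_controlSq_le_two (P := Fin (M + 1) × Fin (M + 1)) M
    (r := fun z => β * √q * z + h) (by fun_prop) hq hfix ht
    (l := 1 / 128 + 4 * (β ^ 2 / 2)) (by positivity) hsmall
  refine (integral_avg₂_mono (fun σ => (continuous_negH _ β h σ).comp (by fun_prop))
    fun σ τ => Real.exp_le_exp.2 (mul_le_mul_of_nonneg_left
      (le_add_of_nonneg_right (sq_nonneg (overlapDev (M + 1) q σ τ))) (by norm_num))).trans ?_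
  exact hmain.trans hend

/-- The disorder law as a marginal of a larger Gaussian family. -/
lemma measurePreserving_gaussN (N : ℕ) (I : Type) [Fintype I] :
    MeasurePreserving (fun (g : (Fin N × Fin N) ⊕ I → ℝ) i j => g (.inl (i, j)))
      (stdGaussianPi ((Fin N × Fin N) ⊕ I)) (gaussN N) := by
  have hinl : MeasurePreserving (fun (g : (Fin N × Fin N) ⊕ I → ℝ) p => g (.inl p))
      (stdGaussianPi ((Fin N × Fin N) ⊕ I)) (stdGaussianPi (Fin N × Fin N)) := by
    have hm : Measurable fun (g : (Fin N × Fin N) ⊕ I → ℝ) p => g (.inl p) := by fun_prop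
    refine ⟨hm, (Measure.pi_eq fun s hs => ?_).symm⟩
    rw [Measure.map_apply hm (MeasurableSet.univ_pi hs)]
    have : (fun (g : (Fin N × Fin N) ⊕ I → ℝ) p => g (.inl p)) ⁻¹' Set.univ.pi s
        = Set.univ.pi (Sum.elim s fun _ => Set.univ) := by
      ext g
      simp [Set.mem_pi]
    rw [this, stdGaussianPi, Measure.pi_pi]
    simp
  have hcurry : MeasurePreserving (MeasurableEquiv.curry (Fin N) (Fin N) ℝ)
      (stdGaussianPi (Fin N × Fin N)) (gaussN N) := by
    refine ⟨MeasurableEquiv.measurable _, ?_⟩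
    have := Measure.infinitePi_map_curry (X := ℝ) fun (_ : Fin N) (_ : Fin N) => gaussianReal 0 1
    simpa only [Measure.infinitePi_eq_pi, stdGaussianPi, gaussN] using this
  exact hcurry.comp hinl

lemma gibbs_eq_avg₂ (N : ℕ) (β h : ℝ) (g : Fin N → Fin N → ℝ) (F : Cfg N → Cfg N → ℝ) :
    gibbs N β h g (fun σs : Fin 1 × Fin 2 → Cfg N => F (σs (0, 0)) (σs (0, 1)))
      = avg₂ (negH N β h g) F := by
  have e := Fintype.sum_equiv (((Equiv.uniqueProd (Fin 2) (Fin 1)).arrowCongr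
      (Equiv.refl (Cfg N))).trans (finTwoArrowEquiv (Cfg N)))
    (fun σs : Fin 1 × Fin 2 → Cfg N => F (σs (0, 0)) (σs (0, 1)) *
      ∏ l, Real.exp (negH N β h g (σs l)))
    (fun q => F q.1 q.2 * (Real.exp (negH N β h g q.1) * Real.exp (negH N β h g q.2)))
    (fun σs => by
      rw [Fintype.prod_prod_type, Fin.prod_univ_one, Fin.prod_univ_two]
      rfl)
  rw [gibbs, e, Fintype.sum_prod_type, sum_div, avg₂]
  refine sum_congr rfl fun σ _ => ?_
  rw [sum_div]
  refine sum_congr rfl fun τ _ => ?_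
  simp only [gibbsWeight, Fintype.card_prod, Fintype.card_fin]
  rw [one_mul, sq, div_mul_div_comm, mul_comm, div_mul_eq_mul_div]

lemma pow_two_mul_le_exp (s : ℝ) (k : ℕ) :
    s ^ (2 * k) ≤ (128 * (k : ℝ)) ^ k * Real.exp (1 / 128 * s ^ 2) := by
  have h := Real.pow_div_factorial_le_exp (1 / 128 * s ^ 2) (by positivity) k
  rw [div_le_iff₀ (by positivity)] at h
  have hk : ((k.factorial : ℕ) : ℝ) ≤ (k : ℝ) ^ k := by exact_mod_cast Nat.factorial_le_pow k
  calc s ^ (2 * k) = 128 ^ k * (1 / 128 * s ^ 2) ^ k := by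
        rw [← mul_pow, pow_mul]; ring
    _ ≤ 128 ^ k * (Real.exp (1 / 128 * s ^ 2) * (k : ℝ) ^ k) := by
        gcongr
        exact h.trans (by gcongr)
    _ = _ := by rw [mul_pow]; ring

end SherringtonKirkpatrick

/-- Theorem 2, exponential integrability, moment form:
`ν((Σ_i t_i σ̄_i)^{2k}) ≤ (Lk)^k` uniformly in `N`, `h` and `(t_i)` with `Σ t_i² = 1`. -/
theorem stmt2 :
    ∃ β₀ L : ℝ, 0 < β₀ ∧ 0 < L ∧
      ∀ β : ℝ, 0 < β → β ≤ β₀ → ∀ h : ℝ, 0 ≤ h → ∀ M : ℕ,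
        ∀ t : Fin (M + 1) → ℝ, (∑ i, t i ^ 2) = 1 → ∀ k : ℕ, 1 ≤ k →
          nu (M + 1) β h
              (fun σs : Fin 1 × Fin 2 → Cfg (M + 1) =>
                Sbar (M + 1) 1 t σs 0 ^ (2 * k)) ≤ (L * k) ^ k := by
  refine ⟨1 / 16, 256, by norm_num, by norm_num, fun β hβ hβ' h _ M t ht k hk => ?_⟩
  set F : Cfg (M + 1) → Cfg (M + 1) → ℝ := fun σ τ => ∑ i, t i * (spin (σ i) - spin (τ i))
    with hF
  have hcont : ∀ σ, Continuous fun g : (Fin (M + 1) × Fin (M + 1)) ⊕ Fin (M + 1) → ℝ =>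
      negH (M + 1) β h (fun i j => g (.inl (i, j))) σ := fun σ =>
    (continuous_negH _ β h σ).comp (by fun_prop)
  have hgibbs : ∀ g, gibbs (M + 1) β h g (fun σs : Fin 1 × Fin 2 → Cfg (M + 1) =>
      Sbar (M + 1) 1 t σs 0 ^ (2 * k)) = avg₂ (negH (M + 1) β h g) fun σ τ => F σ τ ^ (2 * k) :=
    fun g => gibbs_eq_avg₂ (M + 1) β h g fun σ τ => F σ τ ^ (2 * k)
  have hmeas : Continuous fun g =>
      avg₂ (negH (M + 1) β h g) fun σ τ => F σ τ ^ (2 * k) :=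
    continuous_avg₂ (e := fun g => negH (M + 1) β h g) (f := fun _ σ τ => F σ τ ^ (2 * k))
      (continuous_negH (M + 1) β h) fun _ _ => continuous_const
  have hpres := measurePreserving_gaussN (M + 1) (Fin (M + 1))
  rw [nu]
  simp only [hgibbs]
  rw [← hpres.map_eq, integral_map hpres.measurable.aemeasurable hmeas.aestronglyMeasurable]
  refine (integral_avg₂_mono hcont fun σ τ => pow_two_mul_le_exp (F σ τ) k).trans ?_
  simp only [avg₂_const_mul]
  rw [integral_const_mul]
  have hexp := integral_avg₂_negH_exp_sq_le_two M h hβ.le hβ' ht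
  calc _ ≤ (128 * (k : ℝ)) ^ k * 2 := mul_le_mul_of_nonneg_left hexp (by positivity)
    _ ≤ (128 * (k : ℝ)) ^ k * 2 ^ k := by
        gcongr
        exact le_self_pow₀ one_le_two (by omega)
    _ = _ := by rw [← mul_pow]; ring

end
end

section
/- For every 0 ≤ t < 1 and every function f on Σ_N^n, the derivative of ν_t(f) in t equals ν_t′(f) = β² Σ_{1≤l<l′≤n} ν_t(f σ_N^l σ_N^{l′}(R⁻_{l,l′} − q)) − β² n Σ_{l≤n} ν_t(f σ_N^l σ_N^{n+1}(R⁻_{l,n+1} − q)) + β² (n(n+1)/2) ν_t(f σ_N^{n+1} σ_N^{n+2}(R⁻_{n+1,n+2} − q)). -/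
open MeasureTheory ProbabilityTheory Finset

noncomputable section

/-- Minus the one-coordinate interpolating Hamiltonian `-H_{N,t}` (here `N = M+1`, the last
coordinate `σ_N` plays the special role, `z` is an extra standard Gaussian and `q` is the
solution of `q = E tanh²(βz√q + h)`). -/
def negHt (M : ℕ) (β h q s : ℝ) (g : Fin (M + 1) → Fin (M + 1) → ℝ) (z : ℝ)
    (σ : Cfg (M + 1)) : ℝ :=
  (β / Real.sqrt (M + 1)) *
      ∑ i : Fin M, ∑ j : Fin M,
        (if i < j then
          g i.castSucc j.castSucc * spin (σ i.castSucc) * spin (σ j.castSucc) else 0) +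
    Real.sqrt s * (spin (σ (Fin.last M)) * (β / Real.sqrt (M + 1)) *
      ∑ i : Fin M, g i.castSucc (Fin.last M) * spin (σ i.castSucc)) +
    β * Real.sqrt (1 - s) * z * Real.sqrt q * spin (σ (Fin.last M)) +
    h * ∑ i, spin (σ i)

/-- Gibbs average `⟨f⟩_t` for the one-coordinate interpolating Hamiltonian. -/
def gibbsT (M : ℕ) (β h q s : ℝ) (g : Fin (M + 1) → Fin (M + 1) → ℝ) (z : ℝ)
    {ι : Type} [DecidableEq ι] [Fintype ι] (f : (ι → Cfg (M + 1)) → ℝ) : ℝ :=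
  (∑ σs : ι → Cfg (M + 1), f σs * ∏ l, Real.exp (negHt M β h q s g z (σs l))) /
    (∑ σ : Cfg (M + 1), Real.exp (negHt M β h q s g z σ)) ^ (Fintype.card ι)

/-- `ν_t(f) = E⟨f⟩_t` for the one-coordinate interpolation. -/
def nuT (M : ℕ) (β h q s : ℝ) {ι : Type} [DecidableEq ι] [Fintype ι]
    (f : (ι → Cfg (M + 1)) → ℝ) : ℝ :=
  ∫ gz : (Fin (M + 1) → Fin (M + 1) → ℝ) × ℝ, gibbsT M β h q s gz.1 gz.2 f
    ∂ (gaussN (M + 1)).prod (gaussianReal 0 1)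

/-- The truncated overlap `R⁻_{l,l'} = N^{-1} Σ_{i ≤ N-1} σ_i^l σ_i^{l'}` (here `N = M+1`). -/
def overlapMinus (M : ℕ) (σ τ : Cfg (M + 1)) : ℝ :=
  (∑ i : Fin M, spin (σ i.castSucc) * spin (τ i.castSucc)) / (M + 1)

/-- The average of `f` over `n` independent replicas drawn from the Gibbs measure on the finite
set `S` with weights `exp (E σ)`. -/
def replicaAvg {S : Type*} [Fintype S] {n : ℕ} (E : S → ℝ) (f : (Fin n → S) → ℝ) : ℝ :=
  (∑ σs : Fin n → S, f σs * ∏ l, Real.exp (E (σs l))) / (∑ σ : S, Real.exp (E σ)) ^ n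

/-- The function of `n + 1` replicas whose average is the derivative of the average of `f` when
the energy is moved in the direction `v`. -/
def replicaDeriv {S : Type*} {n : ℕ} (f : (Fin n → S) → ℝ) (v : S → ℝ) (σs : Fin (n + 1) → S) : ℝ :=
  f (fun j => σs j.castSucc) * (∑ l : Fin n, v (σs l.castSucc) - n * v (σs (Fin.last n)))

section ReplicaAvg

variable {S : Type*} [Fintype S] {n : ℕ}

lemma sum_exp_pos_s4 [Nonempty S] (E : S → ℝ) : 0 < ∑ σ : S, Real.exp (E σ) :=
  Finset.sum_pos (fun _ _ => Real.exp_pos _) Finset.univ_nonempty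

lemma replicaAvg_add (E : S → ℝ) (f g : (Fin n → S) → ℝ) :
    replicaAvg E (fun σs => f σs + g σs) = replicaAvg E f + replicaAvg E g := by
  simp only [replicaAvg, add_mul, Finset.sum_add_distrib, add_div]

lemma replicaAvg_const_mul (E : S → ℝ) (c : ℝ) (f : (Fin n → S) → ℝ) :
    replicaAvg E (fun σs => c * f σs) = c * replicaAvg E f := by
  simp only [replicaAvg, mul_assoc, ← Finset.mul_sum, mul_div_assoc]

lemma replicaAvg_sum {κ : Type*} (s : Finset κ) (E : S → ℝ) (f : κ → (Fin n → S) → ℝ) :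
    replicaAvg E (fun σs => ∑ k ∈ s, f k σs) = ∑ k ∈ s, replicaAvg E (f k) := by
  simp only [replicaAvg, Finset.sum_mul, ← Finset.sum_div]
  rw [Finset.sum_comm]

lemma replicaAvg_comp_perm (E : S → ℝ) (f : (Fin n → S) → ℝ) (e : Equiv.Perm (Fin n)) :
    replicaAvg E (fun σs => f (σs ∘ e)) = replicaAvg E f := by
  unfold replicaAvg
  congr 1
  refine Fintype.sum_equiv (e.symm.arrowCongr (Equiv.refl S)) _ _ fun σs => ?_
  congr 1
  exact (Equiv.prod_comp e fun l => Real.exp (E (σs l))).symm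

lemma abs_replicaAvg_le [Nonempty S] (E : S → ℝ) {f : (Fin n → S) → ℝ} {C : ℝ}
    (hf : ∀ σs, |f σs| ≤ C) : |replicaAvg E f| ≤ C := by
  have hZ : 0 < (∑ σ : S, Real.exp (E σ)) ^ n := pow_pos (sum_exp_pos_s4 E) n
  rw [replicaAvg, abs_div, abs_of_pos hZ, div_le_iff₀ hZ, Fintype.sum_pow, Finset.mul_sum]
  refine (Finset.abs_sum_le_sum_abs _ _).trans (Finset.sum_le_sum fun σs _ => ?_)
  have hp : 0 < ∏ l, Real.exp (E (σs l)) := Finset.prod_pos fun _ _ => Real.exp_pos _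
  rw [abs_mul, abs_of_pos hp]
  exact mul_le_mul_of_nonneg_right (hf σs) hp.le

lemma exists_abs_replicaAvg_le [Nonempty S] (f : (Fin n → S) → ℝ) :
    ∃ C, 0 ≤ C ∧ ∀ E : S → ℝ, |replicaAvg E f| ≤ C :=
  ⟨∑ σs, |f σs|, by positivity, fun E => abs_replicaAvg_le E fun σs =>
    Finset.single_le_sum (f := fun σs => |f σs|) (fun _ _ => abs_nonneg _) (Finset.mem_univ σs)⟩

lemma continuous_replicaAvg [Nonempty S] (f : (Fin n → S) → ℝ) :
    Continuous fun E : S → ℝ => replicaAvg E f := by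
  unfold replicaAvg
  exact Continuous.div (by fun_prop) (by fun_prop) fun E => (pow_pos (sum_exp_pos_s4 E) n).ne'

lemma replicaAvg_mul_last (E : S → ℝ) (f : (Fin n → S) → ℝ) (v : S → ℝ) :
    replicaAvg E (fun σs : Fin (n + 1) → S => f (fun j => σs j.castSucc) * v (σs (Fin.last n))) =
      replicaAvg E f * ((∑ σ, v σ * Real.exp (E σ)) / ∑ σ, Real.exp (E σ)) := by
  unfold replicaAvg
  rw [div_mul_div_comm, ← pow_succ, ← Equiv.sum_comp (Fin.snocEquiv fun _ => S),
    Fintype.sum_prod_type, Finset.sum_mul_sum, Finset.sum_comm]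
  congr 1
  refine Finset.sum_congr rfl fun σs _ => Finset.sum_congr rfl fun σ _ => ?_
  simp [Fin.snocEquiv, Fin.prod_univ_castSucc]
  ring

lemma replicaAvg_castSucc [Nonempty S] (E : S → ℝ) (f : (Fin n → S) → ℝ) :
    replicaAvg E (fun σs : Fin (n + 1) → S => f (fun j => σs j.castSucc)) = replicaAvg E f := by
  have := replicaAvg_mul_last E f fun _ => 1
  simpa [div_self (sum_exp_pos_s4 E).ne'] using this

lemma replicaAvg_replicaDeriv [Nonempty S] (E : S → ℝ) (f : (Fin n → S) → ℝ) (v : S → ℝ) :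
    replicaAvg E (replicaDeriv f v) =
      replicaAvg E (fun σs => f σs * ∑ l, v (σs l)) -
        n * (replicaAvg E f * ((∑ σ, v σ * Real.exp (E σ)) / ∑ σ, Real.exp (E σ))) := by
  rw [← replicaAvg_mul_last, ← replicaAvg_castSucc E (fun σs => f σs * ∑ l, v (σs l)),
    ← replicaAvg_const_mul, sub_eq_add_neg, ← neg_one_mul, ← replicaAvg_const_mul,
    ← replicaAvg_add]
  congr 1
  funext σs
  simp only [replicaDeriv]
  ring

lemma replicaAvg_replicaDeriv_sum [Nonempty S] {κ : Type*} [Fintype κ] (E : S → ℝ)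
    (f : (Fin n → S) → ℝ) (c : κ → ℝ) (v : κ → S → ℝ) :
    replicaAvg E (replicaDeriv f fun σ => ∑ k, c k * v k σ) =
      ∑ k, c k * replicaAvg E (replicaDeriv f (v k)) := by
  simp only [← replicaAvg_const_mul, ← replicaAvg_sum]
  congr 1
  funext σs
  simp only [replicaDeriv]
  rw [Finset.sum_comm, Finset.mul_sum, ← Finset.sum_sub_distrib, Finset.mul_sum]
  refine Finset.sum_congr rfl fun k _ => ?_
  rw [← Finset.mul_sum]
  ring

lemma HasDerivAt.replicaAvg [Nonempty S] {E : ℝ → S → ℝ} {v : S → ℝ} {t : ℝ}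
    (hE : ∀ σ, HasDerivAt (fun t => E t σ) (v σ) t) (f : (Fin n → S) → ℝ) :
    HasDerivAt (fun t => replicaAvg (E t) f) (replicaAvg (E t) (replicaDeriv f v)) t := by
  have hZ := (sum_exp_pos_s4 (E t)).ne'
  have hnum : HasDerivAt (fun t => ∑ σs : Fin n → S, f σs * ∏ l, Real.exp (E t (σs l)))
      (∑ σs : Fin n → S, f σs * (∑ l, v (σs l)) * ∏ l, Real.exp (E t (σs l))) t := by
    refine HasDerivAt.fun_sum fun σs _ => ?_
    have h := ((HasDerivAt.fun_sum fun l (_ : l ∈ Finset.univ) => hE (σs l)).exp).const_mul (f σs)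
    simp only [Real.exp_sum] at h
    exact h.congr_deriv (by ring)
  have hden : HasDerivAt (fun t => ∑ σ : S, Real.exp (E t σ))
      (∑ σ, v σ * Real.exp (E t σ)) t := by
    refine HasDerivAt.fun_sum fun σ _ => ?_
    simpa [mul_comm] using (hE σ).exp
  have h := hnum.fun_div (hden.fun_pow n) (pow_ne_zero n hZ)
  rw [replicaAvg_replicaDeriv]
  refine h.congr_deriv ?_
  unfold _root_.replicaAvg
  cases n with
  | zero => simp
  | succ m =>
    simp only [Nat.add_sub_cancel]
    field_simp
    ring

end ReplicaAvg

section GaussianIntegrationByParts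

lemma integrable_id_mul_gaussianReal {φ : ℝ → ℝ} {C : ℝ} (hφ : Measurable φ)
    (hC : ∀ x, |φ x| ≤ C) : Integrable (fun x => x * φ x) (gaussianReal 0 1) := by
  have hid : Integrable (fun x : ℝ => x) (gaussianReal 0 1) := IsGaussian.integrable_id
  exact hid.mul_bdd hφ.aestronglyMeasurable (.of_forall hC)

lemma hasDerivAt_gaussianPDFReal (x : ℝ) :
    HasDerivAt (gaussianPDFReal 0 1) (-x * gaussianPDFReal 0 1 x) x := by
  have h : HasDerivAt (fun x : ℝ => -(x - 0) ^ 2 / (2 * ((1 : NNReal) : ℝ))) (-x) x := by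
    refine (((((hasDerivAt_id x).sub_const 0).pow 2).neg).div_const _).congr_deriv ?_
    simp
    ring
  rw [gaussianPDFReal_def]
  refine (h.exp.const_mul _).congr_deriv ?_
  ring

/-- Gaussian integration by parts on the line. -/
lemma integral_id_mul_gaussianReal {φ φ' : ℝ → ℝ} {C C' : ℝ}
    (hφ' : Measurable φ') (hC : ∀ x, |φ x| ≤ C) (hC' : ∀ x, |φ' x| ≤ C')
    (hderiv : ∀ x, HasDerivAt φ (φ' x) x) :
    ∫ x, x * φ x ∂(gaussianReal 0 1) = ∫ x, φ' x ∂(gaussianReal 0 1) := by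
  have hφ : Measurable φ :=
    (continuous_iff_continuousAt.2 fun x => (hderiv x).continuousAt).measurable
  have hconv : ∀ {ψ : ℝ → ℝ}, Integrable ψ (gaussianReal 0 1) →
      Integrable fun x => gaussianPDFReal 0 1 x * ψ x := fun {ψ} h => by
    rw [gaussianReal_of_var_ne_zero _ one_ne_zero,
      integrable_withDensity_iff_integrable_smul' (measurable_gaussianPDF 0 1)
        (.of_forall fun _ => gaussianPDF_lt_top)] at h
    simpa [toReal_gaussianPDF] using h
  have h1 := hconv (integrable_id_mul_gaussianReal hφ hC)
  have h2 : Integrable fun x => gaussianPDFReal 0 1 x * φ' x :=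
    hconv (.of_bound hφ'.aestronglyMeasurable C' (.of_forall hC'))
  have h0 : Integrable fun x => gaussianPDFReal 0 1 x * φ x :=
    hconv (.of_bound hφ.aestronglyMeasurable C (.of_forall hC))
  have key := integral_eq_zero_of_hasDerivAt_of_integrable
    (f := fun x => gaussianPDFReal 0 1 x * φ x)
    (f' := fun x => gaussianPDFReal 0 1 x * φ' x - gaussianPDFReal 0 1 x * (x * φ x))
    (fun x => ((hasDerivAt_gaussianPDFReal x).mul (hderiv x)).congr_deriv (by ring))
    (h2.sub h1) h0
  rw [integral_sub h2 h1, sub_eq_zero] at key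
  simp only [integral_gaussianReal_eq_integral_smul one_ne_zero, smul_eq_mul]
  exact key.symm

/-- Gaussian integration by parts in a coordinate `X` which can be resampled independently of the
others through the measure preserving map `T`. -/
lemma integral_mul_eq_of_resample {Ω Ω' : Type*} [MeasurableSpace Ω] [MeasurableSpace Ω']
    {P : Measure Ω} {ρ : Measure Ω'} [IsProbabilityMeasure ρ]
    {T : Ω' × ℝ → Ω} (hT : MeasurePreserving T (ρ.prod (gaussianReal 0 1)) P)
    {X Φ Φ' : Ω → ℝ} {C C' : ℝ} (hX : ∀ ω t, X (T (ω, t)) = t) (hXm : Measurable X)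
    (hΦ : Measurable Φ) (hΦ' : Measurable Φ') (hC : ∀ ω, |Φ ω| ≤ C) (hC' : ∀ ω, |Φ' ω| ≤ C')
    (hderiv : ∀ ω t, HasDerivAt (fun t => Φ (T (ω, t))) (Φ' (T (ω, t))) t) :
    ∫ ω, X ω * Φ ω ∂P = ∫ ω, Φ' ω ∂P := by
  have hint : Integrable (fun p : Ω' × ℝ => p.2 * Φ (T p)) (ρ.prod (gaussianReal 0 1)) := by
    have hid : Integrable (fun x : ℝ => x) (gaussianReal 0 1) := IsGaussian.integrable_id
    exact (hid.comp_snd ρ).mul_bdd (hΦ.comp hT.measurable).aestronglyMeasurable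
      (.of_forall fun _ => hC _)
  have hint' : Integrable (fun p : Ω' × ℝ => Φ' (T p)) (ρ.prod (gaussianReal 0 1)) :=
    .of_bound (hΦ'.comp hT.measurable).aestronglyMeasurable C' (.of_forall fun _ => hC' _)
  rw [← hT.map_eq, integral_map hT.aemeasurable (by fun_prop),
    integral_map hT.aemeasurable hΦ'.aestronglyMeasurable]
  have hXT : ∀ p : Ω' × ℝ, X (T p) * Φ (T p) = p.2 * Φ (T p) := fun p => by rw [hX]
  simp only [hXT]
  rw [integral_prod _ hint, integral_prod _ hint']
  refine integral_congr_ae (.of_forall fun ω => ?_)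
  exact integral_id_mul_gaussianReal (hΦ'.comp (hT.measurable.comp measurable_prodMk_left))
    (fun _ => hC _) (fun _ => hC' _) (hderiv ω)

lemma measurePreserving_update {ι : Type*} [Fintype ι] [DecidableEq ι] {α : ι → Type*}
    [∀ i, MeasurableSpace (α i)] (μ : ∀ i, Measure (α i)) [∀ i, IsProbabilityMeasure (μ i)]
    (k : ι) :
    MeasurePreserving (fun p : (∀ i, α i) × α k => Function.update p.1 k p.2)
      ((Measure.pi μ).prod (μ k)) (Measure.pi μ) := by
  have hm : Measurable fun p : (∀ i, α i) × α k => Function.update p.1 k p.2 := by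
    refine measurable_pi_iff.2 fun i => ?_
    rcases eq_or_ne i k with rfl | h
    · simpa using measurable_snd
    · simp only [Function.update_of_ne h]
      fun_prop
  refine ⟨hm, (Measure.pi_eq fun s hs => ?_).symm⟩
  rw [Measure.map_apply hm (.univ_pi hs)]
  have hset : (fun p : (∀ i, α i) × α k => Function.update p.1 k p.2) ⁻¹' Set.univ.pi s =
      (Set.univ.pi (Function.update s k Set.univ)) ×ˢ s k := by
    ext p
    simp only [Set.mem_preimage, Set.mem_pi, Set.mem_univ, true_implies, Set.mem_prod]
    refine ⟨fun h => ⟨fun i => ?_, by simpa using h k⟩, fun h i => ?_⟩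
    · rcases eq_or_ne i k with rfl | hi
      · simp
      · simpa [Function.update_of_ne hi] using h i
    · rcases eq_or_ne i k with rfl | hi
      · simpa using h.2
      · simpa [Function.update_of_ne hi] using h.1 i
  rw [hset, Measure.prod_prod, Measure.pi_pi, ← Finset.prod_erase_mul _ _ (Finset.mem_univ k),
    ← Finset.prod_erase_mul Finset.univ (fun i => μ i (s i)) (Finset.mem_univ k)]
  simp only [Function.update_self, measure_univ, mul_one]
  congr 1
  refine Finset.prod_congr rfl fun i hi => ?_
  rw [Function.update_of_ne (Finset.ne_of_mem_erase hi)]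

end GaussianIntegrationByParts

section GaussianInterpolation

variable {Ω S κ : Type*}

/-- The energy `c + ∑ k, θ k * A k * X k`, linear in the variables `X k`. -/
def linearEnergy [Fintype κ] (c : Ω → S → ℝ) (X : κ → Ω → ℝ) (A : κ → S → ℝ) (θ : κ → ℝ)
    (ω : Ω) (σ : S) : ℝ :=
  c ω σ + ∑ k, θ k * (X k ω * A k σ)

variable [MeasurableSpace Ω]

/-- The variable `X k` is a standard Gaussian which can be resampled without changing `c` and the
other variables. -/
def IsFreeGaussian (P : Measure Ω) (c : Ω → S → ℝ) (X : κ → Ω → ℝ) (k : κ) : Prop :=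
  ∃ (Ω' : Type) (_ : MeasurableSpace Ω') (ρ : Measure Ω') (_ : IsProbabilityMeasure ρ)
    (T : Ω' × ℝ → Ω), MeasurePreserving T (ρ.prod (gaussianReal 0 1)) P ∧
      ∀ ω t, X k (T (ω, t)) = t ∧ c (T (ω, t)) = c (T (ω, 0)) ∧
        ∀ j ≠ k, X j (T (ω, t)) = X j (T (ω, 0))

variable {P : Measure Ω} {c : Ω → S → ℝ} {X : κ → Ω → ℝ}

lemma IsFreeGaussian.integrable {k : κ} (hk : IsFreeGaussian P c X k) (hX : Measurable (X k)) :
    Integrable (X k) P := by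
  obtain ⟨Ω', _, ρ, _, T, hT, h⟩ := hk
  rw [← hT.map_eq, integrable_map_measure hX.aestronglyMeasurable hT.aemeasurable]
  have hid : Integrable (fun x : ℝ => x) (gaussianReal 0 1) := IsGaussian.integrable_id
  exact (hid.comp_snd ρ).congr (.of_forall fun p => (h p.1 p.2).1.symm)

variable [Fintype S] [Nonempty S] [Fintype κ] {n : ℕ}

lemma measurable_replicaAvg_linearEnergy (hc : ∀ σ, Measurable fun ω => c ω σ)
    (hX : ∀ k, Measurable (X k)) (A : κ → S → ℝ) (θ : κ → ℝ) (f : (Fin n → S) → ℝ) :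
    Measurable fun ω => replicaAvg (linearEnergy c X A θ ω) f := by
  refine (continuous_replicaAvg f).measurable.comp (measurable_pi_iff.2 fun σ => ?_)
  unfold linearEnergy
  fun_prop

lemma integrable_replicaAvg_linearEnergy [IsFiniteMeasure P]
    (hc : ∀ σ, Measurable fun ω => c ω σ)
    (hX : ∀ k, Measurable (X k)) (A : κ → S → ℝ) (θ : κ → ℝ) (f : (Fin n → S) → ℝ) :
    Integrable (fun ω => replicaAvg (linearEnergy c X A θ ω) f) P := by
  obtain ⟨C, -, hC⟩ := exists_abs_replicaAvg_le f
  exact .of_bound (measurable_replicaAvg_linearEnergy hc hX A θ f).aestronglyMeasurable C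
    (.of_forall fun _ => hC _)

lemma continuous_integral_replicaAvg [IsFiniteMeasure P]
    (hc : ∀ σ, Measurable fun ω => c ω σ) (hX : ∀ k, Measurable (X k)) (A : κ → S → ℝ)
    {θ : κ → ℝ → ℝ} (hθ : ∀ k, Continuous (θ k)) (f : (Fin n → S) → ℝ) :
    Continuous fun u => ∫ ω, replicaAvg (linearEnergy c X A (fun k => θ k u) ω) f ∂P := by
  obtain ⟨C, -, hC⟩ := exists_abs_replicaAvg_le f
  refine continuous_of_dominated (bound := fun _ => C)
    (fun u => (measurable_replicaAvg_linearEnergy hc hX A _ f).aestronglyMeasurable)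
    (fun u => .of_forall fun _ => hC _) (integrable_const C) (.of_forall fun ω => ?_)
  refine (continuous_replicaAvg f).comp (continuous_pi fun σ => ?_)
  unfold linearEnergy
  fun_prop

lemma IsFreeGaussian.integral_mul_replicaAvg {k : κ} (hk : IsFreeGaussian P c X k)
    (hc : ∀ σ, Measurable fun ω => c ω σ) (hX : ∀ k, Measurable (X k)) (A : κ → S → ℝ)
    (θ : κ → ℝ) (f : (Fin n → S) → ℝ) :
    ∫ ω, X k ω * replicaAvg (linearEnergy c X A θ ω) f ∂P =
      θ k * ∫ ω, replicaAvg (linearEnergy c X A θ ω) (replicaDeriv f (A k)) ∂P := by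
  classical
  obtain ⟨Ω', _, ρ, _, T, hT, h⟩ := hk
  obtain ⟨C, -, hC⟩ := exists_abs_replicaAvg_le f
  obtain ⟨C', -, hC'⟩ := exists_abs_replicaAvg_le (replicaDeriv f (A k))
  rw [← integral_const_mul]
  refine integral_mul_eq_of_resample hT (fun ω t => (h ω t).1) (hX k)
    (measurable_replicaAvg_linearEnergy hc hX A θ f)
    ((measurable_replicaAvg_linearEnergy hc hX A θ _).const_mul _) (C := C) (C' := |θ k| * C')
    (fun _ => hC _) (fun ω => ?_) fun ω t => ?_
  · rw [abs_mul]
    exact mul_le_mul_of_nonneg_left (hC' _) (abs_nonneg _)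
  · have hE : ∀ σ, HasDerivAt (fun t => linearEnergy c X A θ (T (ω, t)) σ) (θ k * A k σ) t := by
      intro σ
      have hline : (fun t => linearEnergy c X A θ (T (ω, t)) σ) = fun t =>
          linearEnergy c X A θ (T (ω, 0)) σ + t * (θ k * A k σ) := by
        funext t
        have hX' : ∀ j, X j (T (ω, t)) = X j (T (ω, 0)) + if j = k then t else 0 := by
          intro j
          split_ifs with hj
          · rw [hj, (h ω t).1, (h ω 0).1, zero_add]
          · rw [(h ω t).2.2 j hj, add_zero]
        simp only [linearEnergy, hX', (h ω t).2.1, add_mul, mul_add, Finset.sum_add_distrib, ite_mul,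
          mul_ite, zero_mul, mul_zero, Finset.sum_ite_eq', Finset.mem_univ, if_true]
        ring
      rw [hline]
      simpa using ((hasDerivAt_id t).mul_const (θ k * A k σ)).const_add
        (linearEnergy c X A θ (T (ω, 0)) σ)
    refine (HasDerivAt.replicaAvg hE f).congr_deriv ?_
    simpa using replicaAvg_replicaDeriv_sum (κ := Unit) (linearEnergy c X A θ (T (ω, t))) f
      (fun _ => θ k) (fun _ => A k)

/-- The derivative of a Gaussian interpolation, after integration by parts. -/
lemma hasDerivAt_integral_replicaAvg [IsFiniteMeasure P]
    (hc : ∀ σ, Measurable fun ω => c ω σ) (hX : ∀ k, Measurable (X k))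
    (hfree : ∀ k, IsFreeGaussian P c X k) (A : κ → S → ℝ) {θ θ' : κ → ℝ → ℝ} {s : ℝ}
    (hθ : ∀ᶠ u in nhds s, ∀ k, HasDerivAt (θ k) (θ' k u) u) (hθ' : ∀ k, ContinuousAt (θ' k) s)
    (f : (Fin n → S) → ℝ) :
    HasDerivAt (fun u => ∫ ω, replicaAvg (linearEnergy c X A (fun k => θ k u) ω) f ∂P)
      (∑ k, θ' k s * θ k s * ∫ ω, replicaAvg (linearEnergy c X A (fun k => θ k s) ω)
        (replicaDeriv (replicaDeriv f (A k)) (A k)) ∂P) s := by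
  choose C hC0 hC using fun k => exists_abs_replicaAvg_le (replicaDeriv f (A k))
  have hbound : ∀ᶠ u in nhds s, ∀ k, |θ' k u| ≤ |θ' k s| + 1 :=
    Filter.eventually_all.2 fun k =>
      ((hθ' k).abs.eventually_lt continuousAt_const (lt_add_one _)).mono fun _ h => h.le
  have hint : ∀ k, Integrable (fun ω => X k ω *
      replicaAvg (linearEnergy c X A (fun k => θ k s) ω) (replicaDeriv f (A k))) P := fun k =>
    ((hfree k).integrable (hX k)).mul_bdd
      (measurable_replicaAvg_linearEnergy hc hX A _ _).aestronglyMeasurable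
      (.of_forall fun _ => hC k _)
  have hmain := (hasDerivAt_integral_of_dominated_loc_of_deriv_le (μ := P)
    (F := fun u ω => replicaAvg (linearEnergy c X A (fun k => θ k u) ω) f)
    (F' := fun u ω => ∑ k, θ' k u * (X k ω *
      replicaAvg (linearEnergy c X A (fun k => θ k u) ω) (replicaDeriv f (A k))))
    (bound := fun ω => ∑ k, (|θ' k s| + 1) * (|X k ω| * C k)) (hθ.and hbound)
    (.of_forall fun u => (measurable_replicaAvg_linearEnergy hc hX A _ f).aestronglyMeasurable)
    (integrable_replicaAvg_linearEnergy hc hX A _ f)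
    (integrable_finsetSum _ fun k _ => (hint k).const_mul _).aestronglyMeasurable
    (.of_forall fun ω u hu => ?_)
    (integrable_finsetSum _ fun k _ =>
      ((((hfree k).integrable (hX k)).abs).mul_const _).const_mul _)
    (.of_forall fun ω u hu => ?_)).2
  · refine hmain.congr_deriv ?_
    rw [integral_finsetSum _ fun k _ => (hint k).const_mul _]
    refine Finset.sum_congr rfl fun k _ => ?_
    rw [integral_const_mul, (hfree k).integral_mul_replicaAvg hc hX, mul_assoc]
  · refine (Finset.abs_sum_le_sum_abs _ _).trans (Finset.sum_le_sum fun k _ => ?_)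
    rw [abs_mul, abs_mul]
    gcongr
    · exact hu.2 k
    · exact hC k _
  · have hE : ∀ σ, HasDerivAt (fun u => linearEnergy c X A (fun k => θ k u) ω σ)
        (∑ k, (θ' k u * X k ω) * A k σ) u := fun σ => by
      refine (HasDerivAt.const_add _ (HasDerivAt.fun_sum fun k _ =>
        (hu.1 k).mul_const (X k ω * A k σ))).congr_deriv ?_
      simp only [mul_assoc]
    refine (HasDerivAt.replicaAvg hE f).congr_deriv ?_
    rw [replicaAvg_replicaDeriv_sum]
    simp only [mul_assoc]

end GaussianInterpolation

section ReplicaAlgebra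

lemma sum_sum_eq_diag_add_two_mul {ι : Type*} [Fintype ι] [LinearOrder ι] {F : ι → ι → ℝ}
    (hF : ∀ i j, F i j = F j i) :
    ∑ i, ∑ j, F i j = ∑ i, F i i + 2 * ∑ i, ∑ j, if i < j then F i j else 0 := by
  have hsplit : ∀ i j, F i j =
      (if i = j then F i j else 0) + (if i < j then F i j else 0) + if j < i then F j i else 0 := by
    intro i j
    rcases lt_trichotomy i j with h | h | h
    · simp [h, h.ne, h.not_gt]
    · simp [h]
    · simp [h, h.ne', h.not_gt, hF i j]
  have hswap : ∑ i, ∑ j, (if j < i then F j i else 0) = ∑ i, ∑ j, if i < j then F i j else 0 :=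
    Finset.sum_comm
  calc ∑ i, ∑ j, F i j = ∑ i, ∑ j, ((if i = j then F i j else 0) +
        (if i < j then F i j else 0) + if j < i then F j i else 0) :=
        Finset.sum_congr rfl fun i _ => Finset.sum_congr rfl fun j _ => hsplit i j
    _ = _ := by
      simp only [Finset.sum_add_distrib, hswap, Finset.sum_ite_eq, Finset.mem_univ, if_true]
      ring

lemma sum_mul_replicaDeriv_replicaDeriv {S κ : Type*} [Fintype κ] {n : ℕ} (f : (Fin n → S) → ℝ)
    (A : κ → S → ℝ) (ε : κ → ℝ) {D : S → S → ℝ} (hD : ∀ σ τ, D σ τ = ∑ k, ε k * (A k σ * A k τ))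
    {d : ℝ} (hd : ∀ σ, D σ σ = d) (σs : Fin (n + 2) → S) :
    ∑ k, ε k * replicaDeriv (replicaDeriv f (A k)) (A k) σs =
      2 * ∑ l : Fin n, ∑ l' : Fin n, (if l < l' then f (fun j => σs j.castSucc.castSucc) *
          D (σs l.castSucc.castSucc) (σs l'.castSucc.castSucc) else 0) +
        (1 - n) * ∑ l : Fin n, f (fun j => σs j.castSucc.castSucc) *
          D (σs l.castSucc.castSucc) (σs (Fin.last n).castSucc) -
        (n + 1) * ∑ l : Fin n, f (fun j => σs j.castSucc.castSucc) *
          D (σs l.castSucc.castSucc) (σs (Fin.last (n + 1))) +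
        n * (n + 1) * (f (fun j => σs j.castSucc.castSucc) *
          D (σs (Fin.last n).castSucc) (σs (Fin.last (n + 1)))) := by
  have hsymm : ∀ σ τ, D σ τ = D τ σ := fun σ τ => by simp only [hD, mul_comm (A _ σ)]
  have hdiag : ∀ τ, ∑ l : Fin n, D (σs l.castSucc.castSucc) (σs l.castSucc.castSucc) =
      n * D τ τ := by simp [hd]
  have hdouble : 2 * ∑ l : Fin n, ∑ l' : Fin n,
        (if l < l' then D (σs l.castSucc.castSucc) (σs l'.castSucc.castSucc) else 0) =
      ∑ l : Fin n, ∑ l' : Fin n, D (σs l.castSucc.castSucc) (σs l'.castSucc.castSucc) -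
        n * D (σs (Fin.last n).castSucc) (σs (Fin.last n).castSucc) := by
    rw [eq_sub_iff_add_eq', ← hdiag]
    exact (sum_sum_eq_diag_add_two_mul
      fun l l' : Fin n => hsymm (σs l.castSucc.castSucc) (σs l'.castSucc.castSucc)).symm
  have hpull : ∀ τ, ∑ l : Fin n, D (σs l.castSucc.castSucc) τ =
      ∑ k, ε k * ((∑ l : Fin n, A k (σs l.castSucc.castSucc)) * A k τ) := fun τ => by
    simp only [hD, Finset.sum_mul, Finset.mul_sum]
    exact Finset.sum_comm
  have hpull₂ : ∑ l : Fin n, ∑ l' : Fin n,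
      D (σs l.castSucc.castSucc) (σs l'.castSucc.castSucc) =
      ∑ k, ε k * ((∑ l : Fin n, A k (σs l.castSucc.castSucc)) *
        ∑ l : Fin n, A k (σs l.castSucc.castSucc)) := by
    rw [Finset.sum_comm]
    simp only [hpull]
    rw [Finset.sum_comm]
    simp only [Finset.mul_sum]
  simp only [← mul_ite_zero, ← Finset.mul_sum]
  rw [mul_left_comm 2, hdouble, hpull₂, hpull, hpull, hD, hD]
  simp only [replicaDeriv, Fin.sum_univ_castSucc, Finset.mul_sum (s := (Finset.univ : Finset κ)),
    ← Finset.sum_sub_distrib, ← Finset.sum_add_distrib]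
  refine Finset.sum_congr rfl fun k _ => ?_
  push_cast
  ring

/-- Summing the second derivatives of the replica averages against the signs `ε` produces the
covariance `D`, once the last two replicas are exchanged where necessary. -/
lemma sum_half_mul_map_replicaDeriv_replicaDeriv {S κ : Type*} [Fintype κ] {n : ℕ}
    (L : ((Fin (n + 2) → S) → ℝ) →ₗ[ℝ] ℝ)
    (hL : ∀ F (e : Equiv.Perm (Fin (n + 2))), L (fun σs => F (σs ∘ e)) = L F)
    (f : (Fin n → S) → ℝ) (A : κ → S → ℝ) (ε : κ → ℝ) {D : S → S → ℝ}
    (hD : ∀ σ τ, D σ τ = ∑ k, ε k * (A k σ * A k τ)) {d : ℝ} (hd : ∀ σ, D σ σ = d) :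
    ∑ k, ε k / 2 * L (replicaDeriv (replicaDeriv f (A k)) (A k)) =
      ∑ l : Fin n, ∑ l' : Fin n, (if l < l' then L (fun σs => f (fun j => σs j.castSucc.castSucc) *
          D (σs l.castSucc.castSucc) (σs l'.castSucc.castSucc)) else 0) -
        n * ∑ l : Fin n, L (fun σs => f (fun j => σs j.castSucc.castSucc) *
          D (σs l.castSucc.castSucc) (σs (Fin.last n).castSucc)) +
        n * (n + 1) / 2 * L (fun σs => f (fun j => σs j.castSucc.castSucc) *
          D (σs (Fin.last n).castSucc) (σs (Fin.last (n + 1)))) := by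
  have hexch : ∀ l : Fin n, L (fun σs => f (fun j => σs j.castSucc.castSucc) *
        D (σs l.castSucc.castSucc) (σs (Fin.last (n + 1)))) =
      L (fun σs => f (fun j => σs j.castSucc.castSucc) *
        D (σs l.castSucc.castSucc) (σs (Fin.last n).castSucc)) := fun l => by
    rw [← hL _ (Equiv.swap (Fin.last n).castSucc (Fin.last (n + 1)))]
    have hfix : ∀ j : Fin n, Equiv.swap (Fin.last n).castSucc (Fin.last (n + 1))
        j.castSucc.castSucc = j.castSucc.castSucc := fun j =>
      Equiv.swap_apply_of_ne_of_ne
        (fun h => (Fin.castSucc_lt_last j).ne (Fin.castSucc_injective _ h))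
        (Fin.castSucc_lt_last _).ne
    simp only [Function.comp_apply, hfix, Equiv.swap_apply_right]
  have hsum : ∑ k, ε k • replicaDeriv (replicaDeriv f (A k)) (A k) =
      (2 : ℝ) • (∑ l : Fin n, ∑ l' : Fin n,
        (if l < l' then (fun σs => f (fun j => σs j.castSucc.castSucc) *
          D (σs l.castSucc.castSucc) (σs l'.castSucc.castSucc) :
            (Fin (n + 2) → S) → ℝ) else 0)) +
        (1 - n : ℝ) • (∑ l : Fin n, fun σs => f (fun j => σs j.castSucc.castSucc) *
          D (σs l.castSucc.castSucc) (σs (Fin.last n).castSucc)) -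
        (n + 1 : ℝ) • (∑ l : Fin n, fun σs => f (fun j => σs j.castSucc.castSucc) *
          D (σs l.castSucc.castSucc) (σs (Fin.last (n + 1)))) +
        (n * (n + 1) : ℝ) • (fun σs => f (fun j => σs j.castSucc.castSucc) *
          D (σs (Fin.last n).castSucc) (σs (Fin.last (n + 1)))) := by
    funext σs
    simpa [Finset.sum_apply, ite_apply] using sum_mul_replicaDeriv_replicaDeriv f A ε hD hd σs
  have h := congrArg L hsum
  simp only [map_add, map_sub, map_smul, map_sum, smul_eq_mul, apply_ite L, map_zero, hexch] at h
  simp only [div_mul_eq_mul_div]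
  rw [← Finset.sum_div, h]
  ring

end ReplicaAlgebra

section CavityInterpolation

lemma spin_mul_self (b : Bool) : spin b * spin b = 1 := by cases b <;> simp [spin]

instance isProbabilityMeasure_gaussN (N : ℕ) : IsProbabilityMeasure (gaussN N) := by
  unfold gaussN
  infer_instance

/-- The part of `negHt` which does not depend on the interpolation parameter. -/
def cavityBase (M : ℕ) (β h : ℝ) (ω : (Fin (M + 1) → Fin (M + 1) → ℝ) × ℝ) (σ : Cfg (M + 1)) : ℝ :=
  (β / Real.sqrt (M + 1)) *
      ∑ i : Fin M, ∑ j : Fin M,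
        (if i < j then
          ω.1 i.castSucc j.castSucc * spin (σ i.castSucc) * spin (σ j.castSucc) else 0) +
    h * ∑ i, spin (σ i)

/-- The Gaussian variables `g_{iN}` and `z` which enter the interpolation. -/
def cavityGaussian (M : ℕ) : Option (Fin M) → (Fin (M + 1) → Fin (M + 1) → ℝ) × ℝ → ℝ
  | none, ω => ω.2
  | some i, ω => ω.1 i.castSucc (Fin.last M)

/-- The coefficients of the variables `cavityGaussian` in `negHt`. -/
def cavityCoeff (M : ℕ) (β q : ℝ) : Option (Fin M) → Cfg (M + 1) → ℝ
  | none, σ => β * Real.sqrt q * spin (σ (Fin.last M))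
  | some i, σ => spin (σ (Fin.last M)) * (β / Real.sqrt (M + 1)) * spin (σ i.castSucc)

/-- The interpolation weights `√u` and `√(1 - u)`. -/
def cavityWeight (M : ℕ) : Option (Fin M) → ℝ → ℝ
  | none, u => Real.sqrt (1 - u)
  | some _, u => Real.sqrt u

/-- The derivatives of the interpolation weights. -/
def cavityWeightDeriv (M : ℕ) : Option (Fin M) → ℝ → ℝ
  | none, u => -(1 / (2 * Real.sqrt (1 - u)))
  | some _, u => 1 / (2 * Real.sqrt u)

/-- The derivatives of the squares of the interpolation weights. -/
def cavitySign (M : ℕ) : Option (Fin M) → ℝ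
  | none => -1
  | some _ => 1

variable {M n : ℕ} {β h q : ℝ}

lemma negHt_eq_linearEnergy (u : ℝ) (ω : (Fin (M + 1) → Fin (M + 1) → ℝ) × ℝ) :
    negHt M β h q u ω.1 ω.2 = linearEnergy (cavityBase M β h) (cavityGaussian M)
      (cavityCoeff M β q) (fun k => cavityWeight M k u) ω := by
  funext σ
  simp only [negHt, linearEnergy, cavityBase, cavityGaussian, cavityCoeff, cavityWeight,
    Fintype.sum_option]
  have hsum : ∑ i : Fin M, Real.sqrt u * (ω.1 i.castSucc (Fin.last M) *
        (spin (σ (Fin.last M)) * (β / Real.sqrt (M + 1)) * spin (σ i.castSucc))) =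
      Real.sqrt u * (spin (σ (Fin.last M)) * (β / Real.sqrt (M + 1)) *
        ∑ i : Fin M, ω.1 i.castSucc (Fin.last M) * spin (σ i.castSucc)) := by
    simp only [Finset.mul_sum]
    exact Finset.sum_congr rfl fun i _ => by ring
  rw [hsum]
  ring

lemma nuT_eq_integral_replicaAvg (u : ℝ) (f : (Fin n → Cfg (M + 1)) → ℝ) :
    nuT M β h q u f = ∫ ω, replicaAvg (linearEnergy (cavityBase M β h) (cavityGaussian M)
      (cavityCoeff M β q) (fun k => cavityWeight M k u) ω) f
        ∂(gaussN (M + 1)).prod (gaussianReal 0 1) := by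
  unfold nuT
  refine integral_congr_ae (.of_forall fun ω => ?_)
  simp only [← negHt_eq_linearEnergy, gibbsT, replicaAvg, Fintype.card_fin]

lemma measurable_cavityBase (σ : Cfg (M + 1)) : Measurable fun ω => cavityBase M β h ω σ := by
  unfold cavityBase
  refine ((Finset.measurable_sum _ fun i _ => Finset.measurable_sum _ fun j _ => ?_).const_mul
    _).add_const _
  split_ifs
  · fun_prop
  · fun_prop

lemma measurable_cavityGaussian (k : Option (Fin M)) : Measurable (cavityGaussian M k) := by
  cases k <;> unfold cavityGaussian <;> fun_prop

lemma isFreeGaussian_none :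
    IsFreeGaussian ((gaussN (M + 1)).prod (gaussianReal 0 1)) (cavityBase M β h)
      (cavityGaussian M) none := by
  refine ⟨_, _, gaussN (M + 1), inferInstance, id, .id _, fun ω t => ⟨rfl, rfl, fun j hj => ?_⟩⟩
  cases j with
  | none => exact absurd rfl hj
  | some i => rfl

lemma measurePreserving_update_entry (N : ℕ) (i j : Fin N) :
    MeasurePreserving (fun p : ((Fin N → Fin N → ℝ) × (Fin N → ℝ)) × ℝ =>
        Function.update p.1.1 i (Function.update p.1.2 j p.2))
      (((gaussN N).prod (Measure.pi fun _ => gaussianReal 0 1)).prod (gaussianReal 0 1))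
      (gaussN N) :=
  ((measurePreserving_update (fun _ : Fin N => Measure.pi fun _ : Fin N => gaussianReal 0 1) i).comp
    ((MeasurePreserving.id (gaussN N)).prod
      (measurePreserving_update (fun _ : Fin N => gaussianReal 0 1) j))).comp
    (measurePreserving_prodAssoc _ _ _)

lemma isFreeGaussian_some (i : Fin M) :
    IsFreeGaussian ((gaussN (M + 1)).prod (gaussianReal 0 1)) (cavityBase M β h)
      (cavityGaussian M) (some i) := by
  let ρ := (gaussN (M + 1)).prod (Measure.pi fun _ : Fin (M + 1) => gaussianReal 0 1)
  have hswap : MeasurePreserving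
      (fun p : (((Fin (M + 1) → Fin (M + 1) → ℝ) × (Fin (M + 1) → ℝ)) × ℝ) × ℝ =>
        ((p.1.1, p.2), p.1.2)) ((ρ.prod (gaussianReal 0 1)).prod (gaussianReal 0 1))
      ((ρ.prod (gaussianReal 0 1)).prod (gaussianReal 0 1)) :=
    ((measurePreserving_prodAssoc ρ (gaussianReal 0 1) (gaussianReal 0 1)).symm
      MeasurableEquiv.prodAssoc).comp (((MeasurePreserving.id ρ).prod
        Measure.measurePreserving_swap).comp (measurePreserving_prodAssoc _ _ _))
  refine ⟨_, _, ρ.prod (gaussianReal 0 1), inferInstance, _,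
    ((measurePreserving_update_entry (M + 1) i.castSucc (Fin.last M)).prod
      (.id (gaussianReal 0 1))).comp hswap, fun ω t => ⟨?_, ?_, fun j hj => ?_⟩⟩
  · simp [cavityGaussian]
  · have hentry : ∀ (t : ℝ) (a b : Fin M), Function.update ω.1.1 i.castSucc
        (Function.update ω.1.2 (Fin.last M) t) a.castSucc b.castSucc =
        Function.update ω.1.1 i.castSucc ω.1.2 a.castSucc b.castSucc := fun t a b => by
      rcases eq_or_ne a i with rfl | ha
      · simp
      · simp [Function.update_of_ne (fun e => ha (Fin.castSucc_injective _ e))]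
    funext σ
    simp only [cavityBase, Function.comp_apply, Prod.map_apply, hentry]
  · cases j with
    | none => rfl
    | some j =>
      have hji : j.castSucc ≠ i.castSucc := fun e => hj (by rw [Fin.castSucc_injective _ e])
      simp [cavityGaussian, Function.update_of_ne hji]

lemma isFreeGaussian_cavityGaussian (k : Option (Fin M)) :
    IsFreeGaussian ((gaussN (M + 1)).prod (gaussianReal 0 1)) (cavityBase M β h)
      (cavityGaussian M) k :=
  k.rec isFreeGaussian_none isFreeGaussian_some

lemma continuous_cavityWeight (k : Option (Fin M)) : Continuous (cavityWeight M k) := by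
  cases k <;> unfold cavityWeight <;> fun_prop

lemma hasDerivAt_cavityWeight (k : Option (Fin M)) {u : ℝ} (hu : u ∈ Set.Ioo (0 : ℝ) 1) :
    HasDerivAt (cavityWeight M k) (cavityWeightDeriv M k u) u := by
  cases k with
  | none =>
    exact (((hasDerivAt_id u).const_sub 1).sqrt (sub_pos.2 hu.2).ne').congr_deriv
      (by simp [cavityWeightDeriv, neg_div])
  | some i => exact Real.hasDerivAt_sqrt hu.1.ne'

lemma continuousAt_cavityWeightDeriv (k : Option (Fin M)) {u : ℝ} (hu : u ∈ Set.Ioo (0 : ℝ) 1) :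
    ContinuousAt (cavityWeightDeriv M k) u := by
  have h0 := (Real.sqrt_pos.2 hu.1).ne'
  have h1 := (Real.sqrt_pos.2 (sub_pos.2 hu.2)).ne'
  cases k with
  | none =>
    exact (ContinuousAt.div (by fun_prop) (by fun_prop) (by simpa using h1)).neg
  | some i => exact ContinuousAt.div (by fun_prop) (by fun_prop) (by simpa using h0)

lemma cavityWeightDeriv_mul_cavityWeight (k : Option (Fin M)) {u : ℝ}
    (hu : u ∈ Set.Ioo (0 : ℝ) 1) :
    cavityWeightDeriv M k u * cavityWeight M k u = cavitySign M k / 2 := by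
  have h0 := (Real.sqrt_pos.2 hu.1).ne'
  have h1 := (Real.sqrt_pos.2 (sub_pos.2 hu.2)).ne'
  cases k <;> simp only [cavityWeightDeriv, cavityWeight, cavitySign] <;> field_simp

lemma sum_cavitySign_mul (hq : 0 ≤ q) (σ τ : Cfg (M + 1)) :
    β ^ 2 * (spin (σ (Fin.last M)) * spin (τ (Fin.last M)) * (overlapMinus M σ τ - q)) =
      ∑ k, cavitySign M k * (cavityCoeff M β q k σ * cavityCoeff M β q k τ) := by
  have hM : (β / Real.sqrt (M + 1)) * (β / Real.sqrt (M + 1)) = β ^ 2 / (M + 1) := by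
    rw [div_mul_div_comm, Real.mul_self_sqrt (by positivity), sq]
  have hsum : ∑ i : Fin M, (1 : ℝ) * ((spin (σ (Fin.last M)) * (β / Real.sqrt (M + 1)) *
        spin (σ i.castSucc)) * (spin (τ (Fin.last M)) * (β / Real.sqrt (M + 1)) *
        spin (τ i.castSucc))) =
      spin (σ (Fin.last M)) * spin (τ (Fin.last M)) * (β ^ 2 / (M + 1)) *
        ∑ i : Fin M, spin (σ i.castSucc) * spin (τ i.castSucc) := by
    rw [← hM, Finset.mul_sum]
    exact Finset.sum_congr rfl fun i _ => by ring
  simp only [Fintype.sum_option, cavitySign, cavityCoeff, hsum, overlapMinus]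
  have hq' := Real.mul_self_sqrt hq
  linear_combination
    β ^ 2 * spin (σ (Fin.last M)) * spin (τ (Fin.last M)) * hq'

lemma overlapMinus_self (σ : Cfg (M + 1)) : overlapMinus M σ σ = M / (M + 1) := by
  simp [overlapMinus, spin_mul_self]

lemma continuous_nuT (f : (Fin n → Cfg (M + 1)) → ℝ) : Continuous fun u => nuT M β h q u f := by
  simp only [nuT_eq_integral_replicaAvg]
  exact continuous_integral_replicaAvg measurable_cavityBase measurable_cavityGaussian _
    continuous_cavityWeight f

lemma hasDerivAt_nuT (f : (Fin n → Cfg (M + 1)) → ℝ) {s : ℝ} (hs : s ∈ Set.Ioo (0 : ℝ) 1) :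
    HasDerivAt (fun u => nuT M β h q u f)
      (∑ k, cavitySign M k / 2 * nuT M β h q s
        (replicaDeriv (replicaDeriv f (cavityCoeff M β q k)) (cavityCoeff M β q k))) s := by
  simp only [nuT_eq_integral_replicaAvg, ← cavityWeightDeriv_mul_cavityWeight _ hs]
  exact hasDerivAt_integral_replicaAvg measurable_cavityBase measurable_cavityGaussian
    isFreeGaussian_cavityGaussian _ (Filter.eventually_of_mem (isOpen_Ioo.mem_nhds hs)
      fun u hu k => hasDerivAt_cavityWeight k hu) (fun k => continuousAt_cavityWeightDeriv k hs) f

lemma hasDerivWithinAt_nuT (f : (Fin n → Cfg (M + 1)) → ℝ) {s : ℝ} (hs : s ∈ Set.Ico (0 : ℝ) 1) :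
    HasDerivWithinAt (fun u => nuT M β h q u f)
      (∑ k, cavitySign M k / 2 * nuT M β h q s
        (replicaDeriv (replicaDeriv f (cavityCoeff M β q k)) (cavityCoeff M β q k)))
      (Set.Ico 0 1) s := by
  rcases hs.1.eq_or_lt with rfl | hpos
  · have hIoo : Set.Ioo (0 : ℝ) 1 ∈ nhdsWithin (0 : ℝ) (Set.Ioi 0) := Ioo_mem_nhdsGT one_pos
    refine (hasDerivWithinAt_Ici_of_tendsto_deriv (s := Set.Ioo 0 1)
      (fun u hu => (hasDerivAt_nuT f hu).differentiableAt.differentiableWithinAt)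
      (continuous_nuT f).continuousWithinAt hIoo ?_).mono Set.Ico_subset_Ici_self
    have hcont : Continuous fun u => ∑ k, cavitySign M k / 2 * nuT M β h q u
        (replicaDeriv (replicaDeriv f (cavityCoeff M β q k)) (cavityCoeff M β q k)) :=
      continuous_finsetSum _ fun k _ => (continuous_nuT _).const_mul _
    exact ((hcont.tendsto 0).mono_left nhdsWithin_le_nhds).congr'
      (Filter.eventually_of_mem hIoo fun u hu => (hasDerivAt_nuT f hu).deriv.symm)
  · exact (hasDerivAt_nuT f ⟨hpos, hs.2⟩).hasDerivWithinAt

/-- `nuT` as a linear functional. -/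
def nuTLinear (M n : ℕ) (β h q s : ℝ) : ((Fin n → Cfg (M + 1)) → ℝ) →ₗ[ℝ] ℝ where
  toFun := nuT M β h q s
  map_add' F G := by
    simp only [nuT_eq_integral_replicaAvg]
    rw [← integral_add
      (integrable_replicaAvg_linearEnergy measurable_cavityBase measurable_cavityGaussian _ _ _)
      (integrable_replicaAvg_linearEnergy measurable_cavityBase measurable_cavityGaussian _ _ _)]
    exact integral_congr_ae (.of_forall fun ω => replicaAvg_add _ F G)
  map_smul' a F := by
    simp only [nuT_eq_integral_replicaAvg, RingHom.id_apply, smul_eq_mul]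
    rw [← integral_const_mul]
    exact integral_congr_ae (.of_forall fun ω => replicaAvg_const_mul _ a F)

lemma nuTLinear_comp_perm (s : ℝ) (F : (Fin n → Cfg (M + 1)) → ℝ) (e : Equiv.Perm (Fin n)) :
    nuTLinear M n β h q s (fun σs => F (σs ∘ e)) = nuTLinear M n β h q s F := by
  change nuT M β h q s _ = nuT M β h q s _
  simp only [nuT_eq_integral_replicaAvg, replicaAvg_comp_perm]

end CavityInterpolation

theorem stmt4 :
    ∀ M : ℕ, ∀ β h q : ℝ, 0 < β → 0 ≤ h → 0 ≤ q → q < 1 →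
      q = ∫ z, Real.tanh (β * z * Real.sqrt q + h) ^ 2 ∂ (gaussianReal 0 1 : Measure ℝ) →
      ∀ n : ℕ, 1 ≤ n → ∀ f : (Fin n → Cfg (M + 1)) → ℝ, ∀ s : ℝ, 0 ≤ s → s < 1 →
        HasDerivWithinAt (fun u => nuT M β h q u f)
          ((β ^ 2 *
              ∑ l : Fin n, ∑ l' : Fin n,
                (if l < l' then
                  nuT M β h q s (fun σs : Fin (n + 2) → Cfg (M + 1) =>
                    f (fun j => σs (j.castLE (by omega))) *
                      spin (σs (l.castLE (by omega)) (Fin.last M)) *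
                      spin (σs (l'.castLE (by omega)) (Fin.last M)) *
                      (overlapMinus M (σs (l.castLE (by omega))) (σs (l'.castLE (by omega))) - q))
                else 0)) -
            β ^ 2 * n *
              ∑ l : Fin n,
                nuT M β h q s (fun σs : Fin (n + 2) → Cfg (M + 1) =>
                  f (fun j => σs (j.castLE (by omega))) *
                    spin (σs (l.castLE (by omega)) (Fin.last M)) *
                    spin (σs ⟨n, by omega⟩ (Fin.last M)) *
                    (overlapMinus M (σs (l.castLE (by omega))) (σs ⟨n, by omega⟩) - q)) +
            β ^ 2 * ((n : ℝ) * (n + 1) / 2) *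
              nuT M β h q s (fun σs : Fin (n + 2) → Cfg (M + 1) =>
                f (fun j => σs (j.castLE (by omega))) *
                  spin (σs ⟨n, by omega⟩ (Fin.last M)) *
                  spin (σs ⟨n + 1, by omega⟩ (Fin.last M)) *
                  (overlapMinus M (σs ⟨n, by omega⟩) (σs ⟨n + 1, by omega⟩) - q)))
          (Set.Ico 0 1) s := by
  intro M β h q _ _ hq _ _ n _ f s hs0 hs1
  refine (hasDerivWithinAt_nuT f ⟨hs0, hs1⟩).congr_deriv ?_
  have hmap : ∀ F G : (Fin (n + 2) → Cfg (M + 1)) → ℝ, (∀ σs, F σs = β ^ 2 * G σs) →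
      nuTLinear M (n + 2) β h q s F = β ^ 2 * nuT M β h q s G := fun F G hFG => by
    rw [show F = β ^ 2 • G from funext hFG, map_smul]
    rfl
  have key := sum_half_mul_map_replicaDeriv_replicaDeriv (nuTLinear M (n + 2) β h q s)
    (nuTLinear_comp_perm s) f (cavityCoeff M β q) (cavitySign M) (sum_cavitySign_mul hq)
    (d := β ^ 2 * (M / (M + 1) - q))
    (fun σ => by rw [spin_mul_self, overlapMinus_self, one_mul])
  refine key.trans ?_
  have hpull : ∀ a b : Fin (n + 2), nuTLinear M (n + 2) β h q s
        (fun σs => f (fun j => σs j.castSucc.castSucc) *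
          (β ^ 2 * (spin (σs a (Fin.last M)) * spin (σs b (Fin.last M)) *
            (overlapMinus M (σs a) (σs b) - q)))) =
      β ^ 2 * nuT M β h q s (fun σs => f (fun j => σs j.castSucc.castSucc) *
        spin (σs a (Fin.last M)) * spin (σs b (Fin.last M)) *
          (overlapMinus M (σs a) (σs b) - q)) :=
    fun a b => hmap _ _ fun σs => by ring
  simp only [hpull, ← mul_ite_zero, ← Finset.mul_sum]
  rw [mul_left_comm, mul_left_comm _ (β ^ 2), ← mul_assoc (β ^ 2) (n : ℝ),
    ← mul_assoc (β ^ 2) ((n : ℝ) * (n + 1) / 2)]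
  rfl

end
end
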